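/- Let π = (λ_1, λ_2, …, λ_s ; 0 = a_0, a_1, …, a_{s−1}, a_s = 1) be a Generalized Lakshmibai–Seshadri path of shape λ ∈ P^+ (written with λ_1 ≥ … ≥ λ_s and a_0 ≤ … ≤ a_s, strictness recovered by dropping repeated terms), let i ∈ I^{re} and suppose f_iπ ≠ 0. Write f_+^i(π) = a_t and let p (t+1 ≤ p ≤ s) be such that a_{p−1} < f_-^i(π) ≤ a_p. Then f_iπ = (λ_1, …, λ_t, r_iλ_{t+1}, …, r_iλ_p, λ_p, …, λ_s ; a_0, a_1, …, a_{p−1}, f_-^i(π), a_p, …, a_s), and this is again a Generalized Lakshmibai–Seshadri path of shape λ. In particular the set ℙ_λ of GLS paths of shape λ is stable under f_i for all i ∈ I^{re}. -/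

import Mathlib

namespace GKM

variable {I V : Type*} [AddCommGroup V] [Module ℚ V]

/-- The simple "reflection" `r_i : x ↦ x - α_i^∨(x) • α_i` (an endomorphism of `h*`). -/
def srefl (α : I → V) (coroot : I → (V →ₗ[ℚ] ℚ)) (i : I) : Module.End ℚ V :=
  LinearMap.id - (coroot i).smulRight (α i)

/-- The dual map `h ↦ h - h(α_i) • α_i^∨` on linear functionals; for a real index `i`
this is `r_i^∨ : h ↦ h ∘ r_i⁻¹ = h ∘ r_i`. -/
def crefl (α : I → V) (coroot : I → (V →ₗ[ℚ] ℚ)) (i : I) :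
    Module.End ℚ (V →ₗ[ℚ] ℚ) :=
  LinearMap.id - (LinearMap.applyₗ (α i)).smulRight (coroot i)

/-- The monoid `T` generated by all the `r_i`, `i ∈ I`. -/
def Tmon (α : I → V) (coroot : I → (V →ₗ[ℚ] ℚ)) : Submonoid (Module.End ℚ V) :=
  Submonoid.closure (Set.range (srefl α coroot))

/-- The Weyl group `W` generated by the `r_i` with `i` real; since each generator is an
involution, the submonoid it generates coincides with the group it generates. -/
def Wmon (A : I → I → ℤ) (α : I → V) (coroot : I → (V →ₗ[ℚ] ℚ)) :
    Submonoid (Module.End ℚ V) :=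
  Submonoid.closure (srefl α coroot '' {i | A i i = 2})

/-- `Q^+`, the set of `ℕ`-linear combinations of simple roots. -/
def Qplus (α : I → V) : Set V :=
  {x | ∃ c : I →₀ ℕ, x = c.sum fun i n => (n : ℚ) • α i}

/-- The weight lattice `P`. -/
def Pint (coroot : I → (V →ₗ[ℚ] ℚ)) : Set V :=
  {x | ∀ i, ∃ n : ℤ, coroot i x = (n : ℚ)}

/-- The dominant integral weights `P^+`. -/
def Pplus (coroot : I → (V →ₗ[ℚ] ℚ)) : Set V :=
  {x | (∀ i, ∃ n : ℤ, coroot i x = (n : ℚ)) ∧ ∀ i, 0 ≤ coroot i x}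

/-- The orbit `Tλ`. -/
def Torbit (α : I → V) (coroot : I → (V →ₗ[ℚ] ℚ)) (lam : V) : Set V :=
  {x | ∃ τ, τ ∈ Tmon α coroot ∧ τ lam = x}

/-- The reduced length of `τ ∈ T` with respect to all generators `r_i`, `i ∈ I`. -/
noncomputable def lenT (α : I → V) (coroot : I → (V →ₗ[ℚ] ℚ))
    (τ : Module.End ℚ V) : ℕ :=
  sInf {n | ∃ l : List I, l.length = n ∧ (l.map (srefl α coroot)).prod = τ}

/-- The reduced length of `w ∈ W` with respect to the real generators. -/
noncomputable def lenW (A : I → I → ℤ) (α : I → V) (coroot : I → (V →ₗ[ℚ] ℚ))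
    (w : Module.End ℚ V) : ℕ :=
  sInf {n | ∃ l : List I, (∀ m ∈ l, A m m = 2) ∧ l.length = n ∧
    (l.map (srefl α coroot)).prod = w}

/-- The reflection `r_β : x ↦ x - β^∨(x) • β` attached to a root/coroot pair. -/
def reflRoot (β : V) (βv : V →ₗ[ℚ] ℚ) : Module.End ℚ V :=
  LinearMap.id - βv.smulRight β

/-- A presentation of `β = w α_k ∈ WΠ` together with its coroot `β^∨ = w^∨ α_k^∨`,
via a word `l` (with real entries) for `w`. -/
def IsWRootPres (A : I → I → ℤ) (α : I → V) (coroot : I → (V →ₗ[ℚ] ℚ))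
    (l : List I) (k : I) (β : V) (βv : V →ₗ[ℚ] ℚ) : Prop :=
  (∀ m ∈ l, A m m = 2) ∧
  β = (l.map (srefl α coroot)).prod (α k) ∧
  βv = (l.map (crefl α coroot)).prod (coroot k)

/-- `β ∈ WΠ` with coroot `β^∨`. -/
def IsWRootPair (A : I → I → ℤ) (α : I → V) (coroot : I → (V →ₗ[ℚ] ℚ))
    (β : V) (βv : V →ₗ[ℚ] ℚ) : Prop :=
  ∃ l k, IsWRootPres A α coroot l k β βv

/-- A chain `ν =: c s ← ⋯ ← c 0 := μ` of length `s` inside `Tλ`: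
`c k = r_{β k} (c (k+1))` with `β k ∈ WΠ ∩ Q^+` and `(β k)^∨(c (k+1)) > 0`. -/
def IsChain (A : I → I → ℤ) (α : I → V) (coroot : I → (V →ₗ[ℚ] ℚ))
    (lam μ ν : V) (s : ℕ) (c : ℕ → V) (β : ℕ → V)
    (βv : ℕ → (V →ₗ[ℚ] ℚ)) : Prop :=
  c 0 = μ ∧ c s = ν ∧ (∀ k ≤ s, c k ∈ Torbit α coroot lam) ∧
  ∀ k < s, IsWRootPair A α coroot (β k) (βv k) ∧ β k ∈ Qplus α ∧
    0 < βv k (c (k+1)) ∧ c k = c (k+1) - βv k (c (k+1)) • β k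

/-- `μ > ν` in `Tλ`. -/
def ChainGT (A : I → I → ℤ) (α : I → V) (coroot : I → (V →ₗ[ℚ] ℚ))
    (lam μ ν : V) : Prop :=
  ∃ s, 1 ≤ s ∧ ∃ c β βv, IsChain A α coroot lam μ ν s c β βv

/-- `dist(μ, ν) = n`: there is a chain of length `n` from `μ` to `ν` and every chain
has length at most `n`. -/
def distEq (A : I → I → ℤ) (α : I → V) (coroot : I → (V →ₗ[ℚ] ℚ))
    (lam μ ν : V) (n : ℕ) : Prop :=
  (∃ c β βv, IsChain A α coroot lam μ ν n c β βv) ∧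
  ∀ m c β βv, IsChain A α coroot lam μ ν m c β βv → m ≤ n

/-- An `a`-chain for `(μ, ν)`: a chain in which each step is a covering
(`dist = 1`), `a·β_k^∨(ν_k)` is a positive integer for steps along `WΠ_re`,
and `a·β_k^∨(ν_k) = 1` for steps along `WΠ_im`.  The index `ks k` records the simple
root of which `β k` is a `W`-translate. -/
def IsAChain (A : I → I → ℤ) (α : I → V) (coroot : I → (V →ₗ[ℚ] ℚ))
    (lam : V) (a : ℚ) (μ ν : V) (s : ℕ) (c : ℕ → V)
    (β : ℕ → V) (βv : ℕ → (V →ₗ[ℚ] ℚ)) (ks : ℕ → I) : Prop :=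
  1 ≤ s ∧ IsChain A α coroot lam μ ν s c β βv ∧
  ∀ k < s,
    (∃ l, IsWRootPres A α coroot l (ks k) (β k) (βv k)) ∧
    distEq A α coroot lam (c k) (c (k+1)) 1 ∧
    (A (ks k) (ks k) = 2 → ∃ n : ℕ, 0 < n ∧ a * βv k (c (k+1)) = (n : ℚ)) ∧
    (A (ks k) (ks k) ≠ 2 → a * βv k (c (k+1)) = 1)

/-- Existence of an `a`-chain for `(μ, ν)`. -/
def HasAChain (A : I → I → ℤ) (α : I → V) (coroot : I → (V →ₗ[ℚ] ℚ))
    (lam : V) (a : ℚ) (μ ν : V) : Prop :=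
  ∃ s c β βv ks, IsAChain A α coroot lam a μ ν s c β βv ks

/-- The piecewise-linear path attached to GLS data `(λ_1, …, λ_s ; a_0, …, a_s)`
(weights indexed `1, …, s`, breakpoints indexed `0, …, s`):
on `[a_{j-1}, a_j]` it equals `Σ_{k<j} (a_k - a_{k-1}) • λ_k + (t - a_{j-1}) • λ_j`. -/
def glsPath (lamseq : ℕ → V) (a : ℕ → ℚ) (s : ℕ) (t : ℚ) : V :=
  ∑ k ∈ Finset.range s, (max (min t (a (k+1)) - a k) 0) • lamseq (k+1)

/-- The data of a Generalized Lakshmibai–Seshadri path of shape `lam`. -/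
def IsGLS (A : I → I → ℤ) (α : I → V) (coroot : I → (V →ₗ[ℚ] ℚ))
    (lam : V) (s : ℕ) (lamseq : ℕ → V) (a : ℕ → ℚ) : Prop :=
  1 ≤ s ∧ a 0 = 0 ∧ a s = 1 ∧ (∀ k < s, a k < a (k+1)) ∧
  (∀ k, 1 ≤ k → k ≤ s → lamseq k ∈ Torbit α coroot lam) ∧
  (∀ k, 1 ≤ k → k < s →
    HasAChain A α coroot lam (a k) (lamseq k) (lamseq (k+1))) ∧
  (lamseq s = lam ∨ HasAChain A α coroot lam 1 (lamseq s) lam)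

/-- The set `ℙ_λ` of Generalized Lakshmibai–Seshadri paths of shape `lam`,
realized as functions `ℚ → V` via `glsPath`. -/
def GLSset (A : I → I → ℤ) (α : I → V) (coroot : I → (V →ₗ[ℚ] ℚ))
    (lam : V) : Set (ℚ → V) :=
  {π | ∃ s lamseq a, IsGLS A α coroot lam s lamseq a ∧ π = glsPath lamseq a s}

/-- `h_i^π(t) = α_i^∨(π(t))`. -/
def hFun (coroot : I → (V →ₗ[ℚ] ℚ)) (i : I) (π : ℚ → V) (t : ℚ) : ℚ :=
  coroot i (π t)

/-- `m_i^π`, the minimal integer value attained by `h_i^π` on `[0,1]`. -/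
noncomputable def mOf (coroot : I → (V →ₗ[ℚ] ℚ)) (i : I) (π : ℚ → V) : ℤ :=
  sInf {n : ℤ | ∃ t, 0 ≤ t ∧ t ≤ 1 ∧ hFun coroot i π t = (n : ℚ)}

/-- Two paths agree on `[0,1]`. -/
def pathEq (π π' : ℚ → V) : Prop := ∀ t, 0 ≤ t → t ≤ 1 → π t = π' t

/-- `tp = f_+^i(π)`: the largest point of `[0,1]` where `h_i^π` equals `m_i^π`. -/
def IsFPlus (coroot : I → (V →ₗ[ℚ] ℚ)) (i : I) (π : ℚ → V) (tp : ℚ) : Prop :=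
  0 ≤ tp ∧ tp ≤ 1 ∧ hFun coroot i π tp = (mOf coroot i π : ℚ) ∧
  ∀ t, 0 ≤ t → t ≤ 1 → hFun coroot i π t = (mOf coroot i π : ℚ) → t ≤ tp

/-- `tm = f_-^i(π)`: the smallest point of `[tp,1]` where `h_i^π` equals `m_i^π + 1`. -/
def IsFMinus (coroot : I → (V →ₗ[ℚ] ℚ)) (i : I) (π : ℚ → V) (tp tm : ℚ) : Prop :=
  tp ≤ tm ∧ tm ≤ 1 ∧ hFun coroot i π tm = (mOf coroot i π : ℚ) + 1 ∧
  ∀ t, tp ≤ t → t ≤ 1 → hFun coroot i π t = (mOf coroot i π : ℚ) + 1 → tm ≤ t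

/-- The path `f_i π` (for cutting data `tp = f_+^i(π)`, `tm = f_-^i(π)`). -/
def fPath (α : I → V) (coroot : I → (V →ₗ[ℚ] ℚ)) (i : I) (tp tm : ℚ)
    (π : ℚ → V) (t : ℚ) : V :=
  if t ≤ tp then π t
  else if t ≤ tm then π tp + srefl α coroot i (π t - π tp)
  else π t - α i

/-- `π' = f_i π ≠ 0` (equality of paths on `[0,1]`). -/
def FRel (α : I → V) (coroot : I → (V →ₗ[ℚ] ℚ)) (i : I) (π π' : ℚ → V) : Prop :=
  ∃ tp tm, IsFPlus coroot i π tp ∧ tp < 1 ∧ IsFMinus coroot i π tp tm ∧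
    pathEq π' (fPath α coroot i tp tm π)

/-- `tp = e_+^i(π)` (`i` real): smallest point of `[0,1]` where `h_i^π = m_i^π`. -/
def IsEPlusRe (coroot : I → (V →ₗ[ℚ] ℚ)) (i : I) (π : ℚ → V) (tp : ℚ) : Prop :=
  0 ≤ tp ∧ tp ≤ 1 ∧ hFun coroot i π tp = (mOf coroot i π : ℚ) ∧
  ∀ t, 0 ≤ t → t ≤ 1 → hFun coroot i π t = (mOf coroot i π : ℚ) → tp ≤ t

/-- `tm = e_-^i(π)` (`i` real): largest point of `[0,tp]` where `h_i^π = m_i^π + 1`. -/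
def IsEMinusRe (coroot : I → (V →ₗ[ℚ] ℚ)) (i : I) (π : ℚ → V) (tp tm : ℚ) : Prop :=
  0 ≤ tm ∧ tm ≤ tp ∧ hFun coroot i π tm = (mOf coroot i π : ℚ) + 1 ∧
  ∀ t, 0 ≤ t → t ≤ tp → hFun coroot i π t = (mOf coroot i π : ℚ) + 1 → t ≤ tm

/-- The path `e_i π` for `i` real. -/
def ePathRe (α : I → V) (coroot : I → (V →ₗ[ℚ] ℚ)) (i : I) (tm tp : ℚ)
    (π : ℚ → V) (t : ℚ) : V :=
  if t ≤ tm then π t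
  else if t ≤ tp then π tm + srefl α coroot i (π t - π tm)
  else π t + α i

/-- `π' = e_i π ≠ 0` for a real index `i`. -/
def ERelRe (α : I → V) (coroot : I → (V →ₗ[ℚ] ℚ)) (i : I) (π π' : ℚ → V) : Prop :=
  ∃ tp tm, IsEPlusRe coroot i π tp ∧ 0 < tp ∧ IsEMinusRe coroot i π tp tm ∧
    pathEq π' (ePathRe α coroot i tm tp π)

/-- The "inverse reflection" `r_i^{-1} : x ↦ x + (1/(1-a_{ii})) α_i^∨(x) α_i`
for an imaginary index `i`. -/
def rinv (A : I → I → ℤ) (α : I → V) (coroot : I → (V →ₗ[ℚ] ℚ)) (i : I) :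
    Module.End ℚ V :=
  LinearMap.id + (1 / (1 - (A i i : ℚ))) • (coroot i).smulRight (α i)

/-- `tp = e_+^i(π)` (`i` imaginary): smallest point of `[tm,1]` where
`h_i^π = m_i^π + 1 - a_{ii}` (here `tm = e_-^i(π) = f_+^i(π)`). -/
def IsEPlusIm (A : I → I → ℤ) (coroot : I → (V →ₗ[ℚ] ℚ)) (i : I) (π : ℚ → V)
    (tm tp : ℚ) : Prop :=
  tm ≤ tp ∧ tp ≤ 1 ∧
  hFun coroot i π tp = (mOf coroot i π : ℚ) + 1 - (A i i : ℚ) ∧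
  ∀ t, tm ≤ t → t ≤ 1 →
    hFun coroot i π t = (mOf coroot i π : ℚ) + 1 - (A i i : ℚ) → tp ≤ t

/-- The path `e_i π` for `i` imaginary. -/
def ePathIm (A : I → I → ℤ) (α : I → V) (coroot : I → (V →ₗ[ℚ] ℚ)) (i : I)
    (tm tp : ℚ) (π : ℚ → V) (t : ℚ) : V :=
  if t ≤ tm then π t
  else if t ≤ tp then π tm + rinv A α coroot i (π t - π tm)
  else π t + α i

/-- `π' = e_i π ≠ 0` for an imaginary index `i`:  `e_-^i(π) = f_+^i(π) < 1`, the point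
`e_+^i(π)` exists, and `h_i^π` never drops to `m_i^π - a_{ii}` on `[e_+^i(π), 1]`. -/
def ERelIm (A : I → I → ℤ) (α : I → V) (coroot : I → (V →ₗ[ℚ] ℚ)) (i : I)
    (π π' : ℚ → V) : Prop :=
  ∃ tm tp, IsFPlus coroot i π tm ∧ tm < 1 ∧ IsEPlusIm A coroot i π tm tp ∧
    (∀ t, tp ≤ t → t ≤ 1 →
      (mOf coroot i π : ℚ) - (A i i : ℚ) < hFun coroot i π t) ∧
    pathEq π' (ePathIm A α coroot i tm tp π)

/-- `π' = e_i π ≠ 0`. -/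
def ERel (A : I → I → ℤ) (α : I → V) (coroot : I → (V →ₗ[ℚ] ℚ)) (i : I)
    (π π' : ℚ → V) : Prop :=
  (A i i = 2 ∧ ERelRe α coroot i π π') ∨ (A i i ≠ 2 ∧ ERelIm A α coroot i π π')

/-- `π' = f_{i_1} ⋯ f_{i_k} π ≠ 0` for a list `[i_1, …, i_k]` (rightmost acts first). -/
def FMonRel (α : I → V) (coroot : I → (V →ₗ[ℚ] ℚ)) :
    List I → (ℚ → V) → (ℚ → V) → Prop
  | [], π, π' => pathEq π π'
  | i :: l, π, π' => ∃ πm, FMonRel α coroot l π πm ∧ FRel α coroot i πm π'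

/-- A generalized crystal for the Borcherds–Cartan datum `(A, α, coroot)`. -/
structure GenCrystal (A : I → I → ℤ) (α : I → V)
    (coroot : I → (V →ₗ[ℚ] ℚ)) where
  B : Type*
  wt : B → V
  wt_int : ∀ (i : I) (b : B), ∃ n : ℤ, coroot i (wt b) = (n : ℚ)
  eps : I → B → WithBot ℤ
  phi : I → B → WithBot ℤ
  e : I → B → Option B
  f : I → B → Option B
  phi_eq : ∀ (i : I) (b : B) (n : ℤ), (n : ℚ) = coroot i (wt b) →
    phi i b = eps i b + (n : WithBot ℤ)
  wt_e : ∀ (i : I) (b b' : B), e i b = some b' → wt b' = wt b + α i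
  eps_e_re : ∀ (i : I) (b b' : B), A i i = 2 → e i b = some b' →
    eps i b' = eps i b + ((-1 : ℤ) : WithBot ℤ)
  eps_e_im : ∀ (i : I) (b b' : B), A i i ≠ 2 → e i b = some b' →
    eps i b' = eps i b
  e_iff_f : ∀ (i : I) (b b' : B), e i b = some b' ↔ f i b' = some b
  phi_bot : ∀ (i : I) (b : B), phi i b = ⊥ → e i b = none ∧ f i b = none
  eps_im : ∀ (i : I) (b : B), A i i ≠ 2 → eps i b ≤ 0
  phi_im : ∀ (i : I) (b : B), A i i ≠ 2 → phi i b = ⊥ ∨ 0 ≤ phi i b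

/-- Finite "orthogonal" subsets of the imaginary simple roots, encoded by their
index sets: `F ∈ 𝒫(Π_im)`. -/
def PImSet (A : I → I → ℤ) (F : Finset I) : Prop :=
  (∀ i ∈ F, A i i ≠ 2) ∧ ∀ i ∈ F, ∀ j ∈ F, i ≠ j → A i j = 0

end GKM

namespace GKM

section FormalRoots

variable {I : Type*}

/-- The simple reflection attached to `i` on the formal root lattice of the matrix `B`. -/
noncomputable def latRefl (B : I → I → ℤ) (i : I) : Module.End ℤ (I →₀ ℤ) :=
  LinearMap.id - (Finsupp.linearCombination ℤ (B i)).smulRight (Finsupp.single i 1)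

lemma latRefl_apply (B : I → I → ℤ) (i : I) (v : I →₀ ℤ) :
    latRefl B i v = v - Finsupp.linearCombination ℤ (B i) v • Finsupp.single i (1 : ℤ) := rfl

lemma latRefl_single (B : I → I → ℤ) (i j : I) :
    latRefl B i (Finsupp.single j 1) =
      Finsupp.single j 1 - B i j • Finsupp.single i (1 : ℤ) := by
  simp [latRefl_apply]

lemma latRefl_add_fst {B : I → I → ℤ} {i : I} (h : B i i = 2) (j : I) (v : I →₀ ℤ) (x y : ℤ) :
    latRefl B i (v + x • Finsupp.single i (1 : ℤ) + y • Finsupp.single j (1 : ℤ)) =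
      v + (-x - B i j * y - Finsupp.linearCombination ℤ (B i) v) • Finsupp.single i (1 : ℤ) +
        y • Finsupp.single j (1 : ℤ) := by
  rw [map_add, map_add, map_smul, map_smul, latRefl_single, latRefl_single, latRefl_apply, h]
  module

lemma latRefl_add_snd {B : I → I → ℤ} {j : I} (h : B j j = 2) (i : I) (v : I →₀ ℤ) (x y : ℤ) :
    latRefl B j (v + x • Finsupp.single i (1 : ℤ) + y • Finsupp.single j (1 : ℤ)) =
      v + x • Finsupp.single i (1 : ℤ) +
        (-y - B j i * x - Finsupp.linearCombination ℤ (B j) v) • Finsupp.single j (1 : ℤ) := by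
  rw [add_right_comm, latRefl_add_fst h, add_right_comm]

lemma latRefl_latRefl {B : I → I → ℤ} {i : I} (h : B i i = 2) (v : I →₀ ℤ) :
    latRefl B i (latRefl B i v) = v := by
  simp only [latRefl_apply, map_sub, map_smul, Finsupp.linearCombination_single, h]
  module

/-- The matrix `A` (for roots) or its transpose (for coroots). -/
def dualMat (A : I → I → ℤ) (b : Bool) (i j : I) : ℤ := bif b then A i j else A j i

/-- The simultaneous action of a word in the real simple reflections on the formal root
lattice and on the formal coroot lattice. -/
noncomputable def wordAct (A : I → I → ℤ) (l : List {i // A i i = 2}) :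
    Bool → Module.End ℤ (I →₀ ℤ) :=
  fun b => (l.map fun i => latRefl (dualMat A b) i.1).prod

variable {A : I → I → ℤ}

@[simp] lemma dualMat_self (b : Bool) (i : I) : dualMat A b i i = A i i := by
  cases b <;> rfl

lemma wordAct_nil : wordAct A [] = 1 := rfl

lemma wordAct_append (l l' : List {i // A i i = 2}) :
    wordAct A (l ++ l') = wordAct A l * wordAct A l' := by
  funext b; simp [wordAct]

lemma wordAct_pair_self (i : {i // A i i = 2}) : wordAct A [i, i] = 1 := by
  funext b
  refine LinearMap.ext fun x => ?_
  simpa [wordAct] using latRefl_latRefl (B := dualMat A b) (by simp [i.2]) x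

lemma wordAct_cons_apply (i : {i // A i i = 2}) (l : List {i // A i i = 2}) (b : Bool)
    (v : I →₀ ℤ) :
    wordAct A (i :: l) b v = latRefl (dualMat A b) i.1 (wordAct A l b v) := by
  simp [wordAct]

lemma wordAct_concat_apply (l : List {i // A i i = 2}) (i : {i // A i i = 2}) (b : Bool)
    (v : I →₀ ℤ) :
    wordAct A (l ++ [i]) b v = wordAct A l b (latRefl (dualMat A b) i.1 v) := by
  simp [wordAct]

/-- The alternating word of length `n` in `s, t` ending in `t`. -/
def altWord {J : Type*} (s t : J) : ℕ → List J
  | 0 => []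
  | n + 1 => (if Even n then t else s) :: altWord s t n

/-- Coefficients of the image of the simple root of `s` under `altWord s t n`, where `c` is
the product of the two off-diagonal matrix entries. -/
def altCoef (c : ℤ) : ℕ → ℤ × ℤ
  | 0 => (1, 0)
  | n + 1 => if Even n then ((altCoef c n).1, (altCoef c n).1 - (altCoef c n).2)
      else (c * (altCoef c n).2 - (altCoef c n).1, (altCoef c n).2)

lemma length_altWord {J : Type*} (s t : J) (n : ℕ) : (altWord s t n).length = n := by
  induction n with
  | zero => rfl
  | succ n ih => simp [altWord, ih]

lemma altWord_suffix {J : Type*} (s t : J) {m n : ℕ} (h : m ≤ n) :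
    altWord s t m <:+ altWord s t n := by
  induction n, h using Nat.le_induction with
  | base => exact List.suffix_refl _
  | succ n _ ih => exact ih.trans (List.suffix_cons _ _)

lemma wordAct_altWord (s t : {i // A i i = 2}) (b : Bool) (n : ℕ) :
    wordAct A (altWord s t n) b (Finsupp.single s.1 1) =
      (altCoef (A s.1 t.1 * A t.1 s.1) n).1 • Finsupp.single s.1 (1 : ℤ) +
      (-dualMat A b t.1 s.1 * (altCoef (A s.1 t.1 * A t.1 s.1) n).2) •
        Finsupp.single t.1 (1 : ℤ) := by
  have hc : A s.1 t.1 * A t.1 s.1 = dualMat A b s.1 t.1 * dualMat A b t.1 s.1 := by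
    cases b <;> simp [dualMat, mul_comm]
  induction n with
  | zero => simp [altWord, wordAct_nil, altCoef]
  | succ n ih =>
    rw [altWord, wordAct_cons_apply, ih, altCoef]
    split_ifs with h
    · simp only [map_add, map_smul, latRefl_single, dualMat_self, t.2]
      module
    · simp only [map_add, map_smul, latRefl_single, dualMat_self, s.2, hc]
      module

lemma altCoef_nonneg_of_four_le {c : ℤ} (hc : 4 ≤ c) (n : ℕ) :
    0 ≤ (altCoef c n).1 ∧ 0 ≤ (altCoef c n).2 ∧
    (Even n → 2 * (altCoef c n).2 ≤ (altCoef c n).1) ∧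
    (¬ Even n → (altCoef c n).1 ≤ 2 * (altCoef c n).2) := by
  induction n with
  | zero => simp [altCoef]
  | succ n ih =>
    obtain ⟨h1, h2, h3, h4⟩ := ih
    rw [altCoef]
    by_cases h : Even n
    · have := h3 h
      simp only [h, if_true, Nat.even_add_one, not_true_eq_false, not_false_eq_true,
        forall_true_left, false_imp_iff, true_and]
      omega
    · have := h4 h
      have : 4 * (altCoef c n).2 ≤ c * (altCoef c n).2 := by gcongr
      simp only [h, if_false, Nat.even_add_one, not_true_eq_false, not_false_eq_true,
        forall_true_left, false_imp_iff, and_true]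
      omega

/-- A word is reduced if it has minimal length among the words acting in the same way. -/
def RedWord (A : I → I → ℤ) (l : List {i // A i i = 2}) : Prop :=
  ∀ l', wordAct A l' = wordAct A l → l.length ≤ l'.length

/-- No word shorter than `l` acts as `l` followed by `s`. -/
def NoDescent (A : I → I → ℤ) (l : List {i // A i i = 2}) (s : {i // A i i = 2}) : Prop :=
  ∀ l', wordAct A l' = wordAct A (l ++ [s]) → l.length ≤ l'.length

/-- Both the root and the coroot obtained from `k` by the word `l` are nonnegative. -/
def PosWord (A : I → I → ℤ) (l : List {i // A i i = 2}) (k : I) : Prop :=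
  ∀ b, 0 ≤ wordAct A l b (Finsupp.single k 1)

lemma exists_redWord (l : List {i // A i i = 2}) :
    ∃ l', wordAct A l' = wordAct A l ∧ RedWord A l' ∧ l'.length ≤ l.length := by
  induction h : l.length using Nat.strong_induction_on generalizing l with
  | _ n ih =>
    by_cases hl : RedWord A l
    · exact ⟨l, rfl, hl, h.le⟩
    · simp only [RedWord, not_forall, not_le] at hl
      obtain ⟨l', h1, h2⟩ := hl
      obtain ⟨l'', h3, h4, h5⟩ := ih _ (h ▸ h2) l' rfl
      exact ⟨l'', h3.trans h1, h4, by omega⟩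

lemma RedWord.of_append_right {v u : List {i // A i i = 2}} (h : RedWord A (v ++ u)) :
    RedWord A u := by
  intro l' hl'
  have := h (v ++ l') (by rw [wordAct_append, wordAct_append, hl'])
  simpa using this

lemma RedWord.of_append_left {v u : List {i // A i i = 2}} (h : RedWord A (v ++ u)) :
    RedWord A v := by
  intro l' hl'
  have := h (l' ++ u) (by rw [wordAct_append, wordAct_append, hl'])
  simpa using this

lemma NoDescent.of_append {v u : List {i // A i i = 2}} {s : {i // A i i = 2}}
    (h : NoDescent A (v ++ u) s) : NoDescent A u s := by
  intro l' hl'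
  have := h (v ++ l') (by rw [wordAct_append, hl', List.append_assoc, ← wordAct_append])
  simpa using this

lemma eq_altWord {s t : {i // A i i = 2}} (u : List {i // A i i = 2})
    (hu : ∀ x ∈ u, x = s ∨ x = t) (hr : RedWord A u) (hd : NoDescent A u s) :
    ∃ n, u = altWord s t n := by
  induction u with
  | nil => exact ⟨0, rfl⟩
  | cons x u ih =>
    obtain ⟨n, hn⟩ := ih (fun y hy => hu y (List.mem_cons_of_mem _ hy))
      (RedWord.of_append_right (v := [x]) hr) (NoDescent.of_append (v := [x]) hd)
    refine ⟨n + 1, ?_⟩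
    rw [altWord, ← hn]
    congr 1
    have hx := hu x List.mem_cons_self
    cases n with
    | zero =>
      have hn' : u = [] := hn
      subst hn'
      have hxs : x ≠ s := by
        rintro rfl
        have := hd [] (by rw [wordAct_nil]; exact (wordAct_pair_self x).symm)
        simp at this
      simpa [hxs] using hx
    | succ n =>
      have hne : x ≠ (if Even n then t else s) := by
        intro he
        rw [altWord, ← he] at hn
        have := hr (altWord s t n) (by
          rw [hn]
          change _ = wordAct A ([x, x] ++ altWord s t n)
          rw [wordAct_append, wordAct_pair_self, one_mul])
        simp only [hn, List.length_cons] at this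
        omega
      by_cases h : Even n <;> simp_all [Nat.even_add_one]

lemma altWord_braid (hoff : ∀ i j, i ≠ j → A i j ≤ 0) (hzero : ∀ i j, A i j = 0 ↔ A j i = 0)
    {s t : {i // A i i = 2}} (hst : s ≠ t) (hc : A s.1 t.1 * A t.1 s.1 < 4) :
    ∃ m, (∀ n < m, 0 ≤ (altCoef (A s.1 t.1 * A t.1 s.1) n).1 ∧
        0 ≤ (altCoef (A s.1 t.1 * A t.1 s.1) n).2) ∧
      ¬ NoDescent A (altWord s t m) s := by
  have hne : s.1 ≠ t.1 := fun h => hst (Subtype.ext h)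
  have h1 := hoff _ _ hne
  have h2 := hoff _ _ hne.symm
  have hz := hzero s.1 t.1
  have hs := s.2
  have ht := t.2
  have key : ∀ m l, l.length < m →
      wordAct A l = wordAct A (altWord s t m ++ [s]) → ¬ NoDescent A (altWord s t m) s := by
    intro m l hl he hd
    have := hd l he
    rw [length_altWord] at this
    omega
  generalize hp : A s.1 t.1 = x at *
  generalize hq : A t.1 s.1 = y at *
  have hcases : (x = 0 ∧ y = 0) ∨ (x = -1 ∧ y = -1) ∨ (x = -1 ∧ y = -2) ∨
      (x = -2 ∧ y = -1) ∨ (x = -1 ∧ y = -3) ∨ (x = -3 ∧ y = -1) := by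
    by_cases hx : x = 0
    · exact Or.inl ⟨hx, hz.1 hx⟩
    · have hy : y ≠ 0 := fun h => hx (hz.2 h)
      have hx' : x ≤ -1 := by omega
      have hy' : y ≤ -1 := by omega
      have : -3 ≤ x := by nlinarith
      have : -3 ≤ y := by nlinarith
      interval_cases x <;> interval_cases y <;> simp_all
  have tac : ∀ l l' : List {i // A i i = 2},
      (∀ b v, wordAct A l b (v + (0 : ℤ) • Finsupp.single s.1 (1 : ℤ) +
          (0 : ℤ) • Finsupp.single t.1 (1 : ℤ)) =
        wordAct A l' b (v + (0 : ℤ) • Finsupp.single s.1 (1 : ℤ) +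
          (0 : ℤ) • Finsupp.single t.1 (1 : ℤ))) → wordAct A l = wordAct A l' :=
    fun l l' h => funext fun b => LinearMap.ext fun v => by simpa using h b v
  rcases hcases with ⟨rfl, rfl⟩ | ⟨rfl, rfl⟩ | ⟨rfl, rfl⟩ | ⟨rfl, rfl⟩ | ⟨rfl, rfl⟩ | ⟨rfl, rfl⟩
  · refine ⟨2, ?_, key 2 [t] (by simp) (tac _ _ ?_)⟩
    · decide
    · intro b v
      rw [show altWord s t 2 = [s, t] from rfl]
      cases b <;>
        simp only [List.cons_append, List.nil_append, wordAct_cons_apply, wordAct_nil,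
          Pi.one_apply, Module.End.one_apply,
          latRefl_add_fst, latRefl_add_snd, hs, ht, dualMat, cond, hp, hq] <;>
        module
  · refine ⟨3, ?_, key 3 [s, t] (by simp) (tac _ _ ?_)⟩
    · decide
    · intro b v
      rw [show altWord s t 3 = [t, s, t] from rfl]
      cases b <;>
        simp only [List.cons_append, List.nil_append, wordAct_cons_apply, wordAct_nil,
          Pi.one_apply, Module.End.one_apply,
          latRefl_add_fst, latRefl_add_snd, hs, ht, dualMat, cond, hp, hq] <;>
        module
  · refine ⟨4, ?_, key 4 [t, s, t] (by simp) (tac _ _ ?_)⟩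
    · decide
    · intro b v
      rw [show altWord s t 4 = [s, t, s, t] from rfl]
      cases b <;>
        simp only [List.cons_append, List.nil_append, wordAct_cons_apply, wordAct_nil,
          Pi.one_apply, Module.End.one_apply,
          latRefl_add_fst, latRefl_add_snd, hs, ht, dualMat, cond, hp, hq] <;>
        module
  · refine ⟨4, ?_, key 4 [t, s, t] (by simp) (tac _ _ ?_)⟩
    · decide
    · intro b v
      rw [show altWord s t 4 = [s, t, s, t] from rfl]
      cases b <;>
        simp only [List.cons_append, List.nil_append, wordAct_cons_apply, wordAct_nil,
          Pi.one_apply, Module.End.one_apply,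
          latRefl_add_fst, latRefl_add_snd, hs, ht, dualMat, cond, hp, hq] <;>
        module
  · refine ⟨6, ?_, key 6 [t, s, t, s, t] (by simp) (tac _ _ ?_)⟩
    · decide
    · intro b v
      rw [show altWord s t 6 = [s, t, s, t, s, t] from rfl]
      cases b <;>
        simp only [List.cons_append, List.nil_append, wordAct_cons_apply, wordAct_nil,
          Pi.one_apply, Module.End.one_apply,
          latRefl_add_fst, latRefl_add_snd, hs, ht, dualMat, cond, hp, hq] <;>
        module
  · refine ⟨6, ?_, key 6 [t, s, t, s, t] (by simp) (tac _ _ ?_)⟩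
    · decide
    · intro b v
      rw [show altWord s t 6 = [s, t, s, t, s, t] from rfl]
      cases b <;>
        simp only [List.cons_append, List.nil_append, wordAct_cons_apply, wordAct_nil,
          Pi.one_apply, Module.End.one_apply,
          latRefl_add_fst, latRefl_add_snd, hs, ht, dualMat, cond, hp, hq] <;>
        module

lemma altCoef_nonneg (hoff : ∀ i j, i ≠ j → A i j ≤ 0) (hzero : ∀ i j, A i j = 0 ↔ A j i = 0)
    {s t : {i // A i i = 2}} (hst : s ≠ t) {n : ℕ} (hd : NoDescent A (altWord s t n) s) :
    0 ≤ (altCoef (A s.1 t.1 * A t.1 s.1) n).1 ∧ 0 ≤ (altCoef (A s.1 t.1 * A t.1 s.1) n).2 := by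
  by_cases hc : 4 ≤ A s.1 t.1 * A t.1 s.1
  · have := altCoef_nonneg_of_four_le hc n
    exact ⟨this.1, this.2.1⟩
  · obtain ⟨m, hm, hm'⟩ := altWord_braid hoff hzero hst (not_le.1 hc)
    refine hm n (not_le.1 fun hmn => hm' ?_)
    obtain ⟨v, hv⟩ := altWord_suffix s t hmn
    exact NoDescent.of_append (v := v) (hv ▸ hd)

lemma posWord_of_noDescent (hoff : ∀ i j, i ≠ j → A i j ≤ 0)
    (hzero : ∀ i j, A i j = 0 ↔ A j i = 0) (l : List {i // A i i = 2}) (s : {i // A i i = 2})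
    (hl : RedWord A l) (hd : NoDescent A l s) : PosWord A l s.1 := by
  induction hn : l.length using Nat.strong_induction_on generalizing l s with
  | _ n ih =>
    rcases List.eq_nil_or_concat l with rfl | ⟨l₀, t, hlt⟩
    · intro b; simp [wordAct_nil]
    have hst : s ≠ t := by
      rintro rfl
      have := hd l₀ (by
        rw [hlt, List.concat_eq_append, List.append_assoc, wordAct_append]
        simp [wordAct_pair_self])
      simp [hlt] at this
    classical
    have hex : ∃ k, ∃ v u : List {i // A i i = 2}, v.length = k ∧ (∀ x ∈ u, x = s ∨ x = t) ∧
        wordAct A (v ++ u) = wordAct A l ∧ v.length + u.length = l.length :=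
      ⟨_, l₀, [t], rfl, by simp, by simp [hlt], by simp [hlt]⟩
    obtain ⟨v, u, hv, hu, hvu, hlen⟩ := Nat.find_spec hex
    have hmin : ∀ v' u' : List {i // A i i = 2}, (∀ x ∈ u', x = s ∨ x = t) →
        wordAct A (v' ++ u') = wordAct A l → v'.length + u'.length = l.length →
        v.length ≤ v'.length := fun v' u' h1 h2 h3 =>
      hv ▸ Nat.find_min' hex ⟨v', u', rfl, h1, h2, h3⟩
    have hvl : v.length < l.length := by
      have := hmin l₀ [t] (by simp) (by simp [hlt]) (by simp [hlt])
      simp only [hlt, List.length_concat]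
      omega
    have hvur : RedWord A (v ++ u) := by
      intro l' hl'
      rw [List.length_append, hlen]
      exact hl l' (hl'.trans hvu)
    have hvud : NoDescent A (v ++ u) s := by
      intro l' hl'
      rw [List.length_append, hlen]
      exact hd l' (by rw [hl', wordAct_append, hvu, ← wordAct_append])
    have hvd : ∀ x, x = s ∨ x = t → NoDescent A v x := by
      intro x hx l' hl'
      by_contra! hlt'
      have he : wordAct A (l' ++ x :: u) = wordAct A l := by
        rw [← hvu, wordAct_append, hl', ← wordAct_append]
        change wordAct A ((v ++ [x]) ++ ([x] ++ u)) = _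
        rw [← List.append_assoc, List.append_assoc v, wordAct_append, wordAct_append,
          List.singleton_append, wordAct_pair_self, mul_one, wordAct_append]
      have h1 := hl _ he
      simp only [List.length_append, List.length_cons] at h1
      have h2 := hmin l' (x :: u) (fun y hy => by
        rcases List.mem_cons.1 hy with rfl | hy
        exacts [hx, hu _ hy]) he (by
        simp only [List.length_cons]; omega)
      omega
    have hps := ih _ (hn ▸ hvl) v s hvur.of_append_left (hvd s (Or.inl rfl)) rfl
    have hpt := ih _ (hn ▸ hvl) v t hvur.of_append_left (hvd t (Or.inr rfl)) rfl
    obtain ⟨k, hk⟩ := eq_altWord u hu hvur.of_append_right hvud.of_append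
    obtain ⟨hx, hy⟩ := altCoef_nonneg hoff hzero hst (hk ▸ hvud.of_append)
    intro b
    rw [← hvu, wordAct_append, hk, Pi.mul_apply, Module.End.mul_apply, wordAct_altWord]
    simp only [map_add, map_smul]
    have hne : s.1 ≠ t.1 := fun h => hst (Subtype.ext h)
    have hneg : 0 ≤ -dualMat A b t.1 s.1 := by
      cases b
      · simpa [dualMat] using hoff _ _ hne
      · simpa [dualMat] using hoff _ _ hne.symm
    exact add_nonneg (smul_nonneg hx (hps b)) (smul_nonneg (mul_nonneg hneg hy) (hpt b))

lemma posWord_or_neg (hoff : ∀ i j, i ≠ j → A i j ≤ 0)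
    (hzero : ∀ i j, A i j = 0 ↔ A j i = 0) (l : List {i // A i i = 2}) (s : {i // A i i = 2}) :
    PosWord A l s.1 ∨ ∀ b, wordAct A l b (Finsupp.single s.1 1) ≤ 0 := by
  obtain ⟨l₁, h1, hr, -⟩ := exists_redWord l
  by_cases hd : NoDescent A l₁ s
  · left
    intro b
    rw [← h1]
    exact posWord_of_noDescent hoff hzero l₁ s hr hd b
  · right
    simp only [NoDescent, not_forall, not_le] at hd
    obtain ⟨l', h2, h3⟩ := hd
    obtain ⟨l₂, h4, hr2, h5⟩ := exists_redWord l'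
    have h6 : wordAct A (l₂ ++ [s]) = wordAct A l₁ := by
      rw [wordAct_append, h4, h2, ← wordAct_append, List.append_assoc, wordAct_append]
      simp [wordAct_pair_self]
    have hp := posWord_of_noDescent hoff hzero l₂ s hr2 (fun l'' h => by
      have := hr l'' (h.trans h6)
      omega)
    intro b
    have := hp b
    rw [← h1, ← h6, wordAct_concat_apply, latRefl_single, dualMat_self, s.2,
      show Finsupp.single s.1 (1 : ℤ) - (2 : ℤ) • Finsupp.single s.1 (1 : ℤ)
        = -Finsupp.single s.1 (1 : ℤ) by module, map_neg]
    simpa using this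

lemma posWord_of_imaginary (hoff : ∀ i j, i ≠ j → A i j ≤ 0)
    (hzero : ∀ i j, A i j = 0 ↔ A j i = 0) (l : List {i // A i i = 2}) {k : I}
    (hk : A k k ≠ 2) : PosWord A l k := by
  induction hn : l.length using Nat.strong_induction_on generalizing l with
  | _ n ih =>
    by_cases hr : RedWord A l
    · rcases List.eq_nil_or_concat l with rfl | ⟨l₀, t, hlt⟩
      · intro b; simp [wordAct_nil]
      rw [List.concat_eq_append] at hlt
      subst hlt
      have hp := posWord_of_noDescent hoff hzero l₀ t hr.of_append_left (fun l' hl' => by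
        have := hr l' hl'
        rw [List.length_append] at this
        omega)
      have h0 := ih l₀.length (by rw [← hn]; simp) l₀ rfl
      intro b
      have hne : t.1 ≠ k := fun h => hk (h ▸ t.2)
      have hneg : 0 ≤ -dualMat A b t.1 k := by
        cases b
        · simpa [dualMat] using hoff _ _ hne.symm
        · simpa [dualMat] using hoff _ _ hne
      rw [wordAct_concat_apply, latRefl_single, sub_eq_add_neg, ← neg_smul, map_add, map_smul]
      exact add_nonneg (h0 b) (smul_nonneg hneg (hp b))
    · simp only [RedWord, not_forall, not_le] at hr
      obtain ⟨l', h1, h2⟩ := hr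
      have := ih _ (hn ▸ h2) l' rfl
      intro b
      rw [← h1]
      exact this b

end FormalRoots
end GKM

namespace GKM

section Roots

variable {I V : Type*} [AddCommGroup V] [Module ℚ V]

/-- A realization of a Borcherds–Cartan matrix with linearly independent simple roots. -/
structure IsRealization (A : I → I → ℤ) (α : I → V) (coroot : I → (V →ₗ[ℚ] ℚ)) : Prop where
  linearIndependent : LinearIndependent ℚ α
  pairing : ∀ i j, coroot i (α j) = (A i j : ℚ)
  nonpos : ∀ i j, i ≠ j → A i j ≤ 0
  zero_iff : ∀ i j, A i j = 0 ↔ A j i = 0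

variable {A : I → I → ℤ} {α : I → V} {coroot : I → (V →ₗ[ℚ] ℚ)}

lemma srefl_apply (i : I) (x : V) : srefl α coroot i x = x - coroot i x • α i := rfl

lemma crefl_apply (i : I) (f : V →ₗ[ℚ] ℚ) (x : V) :
    crefl α coroot i f x = f (srefl α coroot i x) := by
  simp [crefl, srefl_apply, mul_comm]

namespace IsRealization

variable (hD : IsRealization A α coroot)
include hD

lemma coroot_self {i : I} (hi : A i i = 2) : coroot i (α i) = 2 := by
  rw [hD.pairing, hi]; norm_num

lemma coroot_srefl {i : I} (hi : A i i = 2) (x : V) :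
    coroot i (srefl α coroot i x) = -coroot i x := by
  rw [srefl_apply, map_sub, map_smul, hD.coroot_self hi, smul_eq_mul]; ring

lemma srefl_srefl {i : I} (hi : A i i = 2) (x : V) :
    srefl α coroot i (srefl α coroot i x) = x := by
  rw [srefl_apply _ (srefl α coroot i x), hD.coroot_srefl hi, srefl_apply]; module

lemma srefl_injective {i : I} (hi : A i i = 2) : Function.Injective (srefl α coroot i) :=
  Function.LeftInverse.injective (hD.srefl_srefl hi)

lemma linearCombination_injective :
    Function.Injective (Finsupp.linearCombination ℤ α) := by
  refine hD.linearIndependent.restrict_scalars (R := ℤ) ?_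
  intro m n h
  simpa using h

lemma linearCombination_latRefl (i : I) (v : I →₀ ℤ) :
    Finsupp.linearCombination ℤ α (latRefl (dualMat A true) i v) =
      srefl α coroot i (Finsupp.linearCombination ℤ α v) := by
  induction v using Finsupp.induction_linear with
  | zero => simp
  | add f g hf hg => simp only [map_add, hf, hg]
  | single j n =>
    have h : Finsupp.single j n = n • Finsupp.single j (1 : ℤ) := by simp
    rw [h, map_smul, map_smul, latRefl_single, map_smul, map_zsmul]
    congr 1
    simp [srefl_apply, hD.pairing, dualMat, Int.cast_smul_eq_zsmul]

lemma linearCombination_latRefl_dual (i : I) (v : I →₀ ℤ) :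
    Finsupp.linearCombination ℤ coroot (latRefl (dualMat A false) i v) =
      crefl α coroot i (Finsupp.linearCombination ℤ coroot v) := by
  induction v using Finsupp.induction_linear with
  | zero => simp
  | add f g hf hg => simp only [map_add, hf, hg]
  | single j n =>
    have h : Finsupp.single j n = n • Finsupp.single j (1 : ℤ) := by simp
    rw [h, map_smul, map_smul, latRefl_single, map_smul, map_zsmul]
    congr 1
    simp [crefl, hD.pairing, dualMat, Int.cast_smul_eq_zsmul]

lemma linearCombination_wordAct (l : List {i // A i i = 2}) (v : I →₀ ℤ) :
    Finsupp.linearCombination ℤ α (wordAct A l true v) =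
      ((l.map Subtype.val).map (srefl α coroot)).prod (Finsupp.linearCombination ℤ α v) := by
  induction l with
  | nil => rfl
  | cons i l ih => rw [wordAct_cons_apply, hD.linearCombination_latRefl, ih]; simp

lemma linearCombination_wordAct_dual (l : List {i // A i i = 2}) (v : I →₀ ℤ) :
    Finsupp.linearCombination ℤ coroot (wordAct A l false v) =
      ((l.map Subtype.val).map (crefl α coroot)).prod
        (Finsupp.linearCombination ℤ coroot v) := by
  induction l with
  | nil => rfl
  | cons i l ih => rw [wordAct_cons_apply, hD.linearCombination_latRefl_dual, ih]; simp

end IsRealization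

lemma mem_Qplus_iff {x : V} :
    x ∈ Qplus α ↔ ∃ b : I →₀ ℤ, 0 ≤ b ∧ x = Finsupp.linearCombination ℤ α b := by
  constructor
  · rintro ⟨c, rfl⟩
    refine ⟨c.mapRange (Nat.cast : ℕ → ℤ) (by simp), fun i => by simp, ?_⟩
    rw [Finsupp.linearCombination_apply, Finsupp.sum_mapRange_index (by simp)]
    refine Finsupp.sum_congr fun i _ => ?_
    rw [← Int.cast_smul_eq_zsmul ℚ]; simp
  · rintro ⟨b, hb, rfl⟩
    refine ⟨b.mapRange Int.toNat (by simp), ?_⟩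
    rw [Finsupp.linearCombination_apply, Finsupp.sum_mapRange_index (by simp)]
    refine Finsupp.sum_congr fun i _ => ?_
    rw [← Int.cast_smul_eq_zsmul ℚ, ← Int.cast_natCast, Int.toNat_of_nonneg (hb i)]

lemma IsWRootPres.cons {l : List I} {k : I} {β : V} {βv : V →ₗ[ℚ] ℚ}
    (h : IsWRootPres A α coroot l k β βv) {i : I} (hi : A i i = 2) :
    IsWRootPres A α coroot (i :: l) k (srefl α coroot i β) (crefl α coroot i βv) := by
  obtain ⟨h1, rfl, rfl⟩ := h
  exact ⟨by simpa using ⟨hi, h1⟩, by simp, by simp⟩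

lemma eq_single_of_latRefl_nonpos {B : I → I → ℤ} {i : I} {b : I →₀ ℤ} (hb : 0 ≤ b)
    (h : latRefl B i b ≤ 0) : b = Finsupp.single i (b i) := by
  classical
  ext j
  by_cases hj : i = j
  · simp [hj]
  · have h1 := h j
    have h2 := hb j
    simp only [latRefl_apply, Finsupp.coe_sub, Pi.sub_apply, Finsupp.coe_smul, Pi.smul_apply,
      Finsupp.single_apply, hj, Finsupp.coe_zero, Pi.zero_apply] at h1 h2 ⊢
    simp only [if_false, smul_zero, sub_zero] at h1 ⊢
    omega

namespace IsRealization

variable (hD : IsRealization A α coroot)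
include hD

lemma root_ne_zero {l : List I} {k : I} {β : V} {βv : V →ₗ[ℚ] ℚ}
    (h : IsWRootPres A α coroot l k β βv) : β ≠ 0 := by
  obtain ⟨hl, rfl, -⟩ := h
  induction l with
  | nil => simpa using hD.linearIndependent.ne_zero k
  | cons i l ih =>
    simp only [List.map_cons, List.prod_cons, Module.End.mul_apply]
    exact (map_ne_zero_iff _ (hD.srefl_injective (hl i List.mem_cons_self))).2
      (ih fun m hm => hl m (List.mem_cons_of_mem _ hm))

lemma coroot_root {l : List I} {k : I} {β : V} {βv : V →ₗ[ℚ] ℚ}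
    (h : IsWRootPres A α coroot l k β βv) : βv β = A k k := by
  obtain ⟨hl, rfl, rfl⟩ := h
  induction l with
  | nil => simpa using hD.pairing k k
  | cons i l ih =>
    simp only [List.map_cons, List.prod_cons, Module.End.mul_apply, crefl_apply]
    rw [hD.srefl_srefl (hl i List.mem_cons_self)]
    exact ih fun m hm => hl m (List.mem_cons_of_mem _ hm)

/-- A real simple reflection permutes the positive elements of `WΠ` other than the
corresponding simple root. -/
lemma srefl_mem_Qplus_or {l : List I} {k : I} {β : V} {βv : V →ₗ[ℚ] ℚ}
    (h : IsWRootPres A α coroot l k β βv) (hβ : β ∈ Qplus α) {i : I} (hi : A i i = 2) :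
    (A k k = 2 ∧ β = α i ∧ βv = coroot i) ∨ srefl α coroot i β ∈ Qplus α := by
  have hvv := hD.coroot_root h
  have hne := hD.root_ne_zero h
  obtain ⟨hl, h1, h2⟩ := h
  lift l to List {i // A i i = 2} using hl
  have e1 : β = Finsupp.linearCombination ℤ α (wordAct A l true (Finsupp.single k 1)) := by
    rw [hD.linearCombination_wordAct, h1]; simp
  have e2 : βv = Finsupp.linearCombination ℤ coroot
      (wordAct A l false (Finsupp.single k 1)) := by
    rw [hD.linearCombination_wordAct_dual, h2]; simp
  have e3 : srefl α coroot i β = Finsupp.linearCombination ℤ α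
      (wordAct A (⟨i, hi⟩ :: l) true (Finsupp.single k 1)) := by
    rw [wordAct_cons_apply, hD.linearCombination_latRefl, e1]
  have hb0 : 0 ≤ wordAct A l true (Finsupp.single k 1) := by
    obtain ⟨b, hb, hb'⟩ := mem_Qplus_iff.1 hβ
    rwa [hD.linearCombination_injective (e1.symm.trans hb')]
  by_cases hk : A k k = 2
  · rcases posWord_or_neg hD.nonpos hD.zero_iff (⟨i, hi⟩ :: l) ⟨k, hk⟩ with hp | hn
    · exact Or.inr (mem_Qplus_iff.2 ⟨_, hp true, e3⟩)
    · left
      have hc0 : 0 ≤ wordAct A l false (Finsupp.single k 1) := by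
        rcases posWord_or_neg hD.nonpos hD.zero_iff l ⟨k, hk⟩ with hp | hn'
        · exact hp false
        · exact absurd (by rw [e1, le_antisymm (hn' true) hb0, map_zero]) hne
      have hs := eq_single_of_latRefl_nonpos hb0 (by
        simpa only [wordAct_cons_apply] using hn true)
      have hs' := eq_single_of_latRefl_nonpos hc0 (by
        simpa only [wordAct_cons_apply] using hn false)
      have p1 := hb0 i
      have p2 := hc0 i
      generalize wordAct A l true (Finsupp.single k 1) = b at *
      generalize wordAct A l false (Finsupp.single k 1) = c at *
      rw [hs, Finsupp.linearCombination_single] at e1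
      rw [hs', Finsupp.linearCombination_single] at e2
      have hprod : c i * b i = 1 := by
        rw [e1, e2, map_zsmul, LinearMap.smul_apply, hD.coroot_self hi, hk] at hvv
        simp only [zsmul_eq_mul] at hvv
        have : ((c i * b i : ℤ) : ℚ) = 1 := by push_cast at hvv ⊢; linarith
        exact_mod_cast this
      have q : b i = 1 := by
        rcases Int.eq_one_or_neg_one_of_mul_eq_one' hprod with ⟨-, h⟩ | ⟨-, h⟩
        · exact h
        · rw [h] at p1; simp at p1
      have q' : c i = 1 := by rwa [q, mul_one] at hprod
      exact ⟨hk, by simpa [q] using e1, by simpa [q'] using e2⟩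
  · exact Or.inr (mem_Qplus_iff.2
      ⟨_, posWord_of_imaginary hD.nonpos hD.zero_iff (⟨i, hi⟩ :: l) hk true, e3⟩)

lemma eq_simple_of_smul {l : List I} {k : I} {β : V} {βv : V →ₗ[ℚ] ℚ}
    (h : IsWRootPres A α coroot l k β βv) (hβ : β ∈ Qplus α) {i : I} (hi : A i i = 2)
    {x : ℚ} (hx : β = x • α i) : β = α i ∧ βv = coroot i := by
  rcases hD.srefl_mem_Qplus_or h hβ hi with h' | h'
  · exact h'.2
  · exfalso
    obtain ⟨b, hb, hb'⟩ := mem_Qplus_iff.1 hβ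
    obtain ⟨c, hc, hc'⟩ := mem_Qplus_iff.1 h'
    have : srefl α coroot i β = -β := by
      rw [hx, srefl_apply, map_smul, hD.coroot_self hi, smul_eq_mul]; module
    have hbc : c = -b := hD.linearCombination_injective (by rw [map_neg, ← hb', ← hc', this])
    have : b = 0 := le_antisymm (by rw [hbc] at hc; simpa using hc) hb
    exact hD.root_ne_zero h (by rw [hb', this, map_zero])

lemma coroot_int_of_mem_Qplus {β : V} (hβ : β ∈ Qplus α) (i : I) :
    ∃ n : ℤ, coroot i β = n := by
  obtain ⟨b, -, rfl⟩ := mem_Qplus_iff.1 hβ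
  refine ⟨Finsupp.linearCombination ℤ (A i) b, ?_⟩
  simp [Finsupp.linearCombination_apply, Finsupp.sum, hD.pairing]

end IsRealization

end Roots
end GKM

namespace GKM

section Chains

variable {I V : Type*} [AddCommGroup V] [Module ℚ V]

/-- `μ` is obtained from `ν` by the reflection in the positive root `β`, moving upwards in the
order on the orbit of `lam`. -/
structure ChainStep (A : I → I → ℤ) (α : I → V) (coroot : I → (V →ₗ[ℚ] ℚ)) (lam μ ν β : V)
    (βv : V →ₗ[ℚ] ℚ) : Prop where
  left_mem : μ ∈ Torbit α coroot lam
  right_mem : ν ∈ Torbit α coroot lam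
  isRoot : IsWRootPair A α coroot β βv
  mem_Qplus : β ∈ Qplus α
  pos : 0 < βv ν
  eq : μ = ν - βv ν • β

/-- There is a chain of length `n` from `μ` down to `ν`. -/
def HasChain (A : I → I → ℤ) (α : I → V) (coroot : I → (V →ₗ[ℚ] ℚ)) (lam : V) (n : ℕ)
    (μ ν : V) : Prop :=
  ∃ c β βv, IsChain A α coroot lam μ ν n c β βv

/-- A single step of an `a`-chain. -/
def AStep (A : I → I → ℤ) (α : I → V) (coroot : I → (V →ₗ[ℚ] ℚ)) (lam : V) (a : ℚ)
    (μ ν : V) : Prop :=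
  ∃ β βv k, (∃ l, IsWRootPres A α coroot l k β βv) ∧ ChainStep A α coroot lam μ ν β βv ∧
    distEq A α coroot lam μ ν 1 ∧
    (A k k = 2 → ∃ n : ℕ, 0 < n ∧ a * βv ν = (n : ℚ)) ∧
    (A k k ≠ 2 → a * βv ν = 1)

variable {A : I → I → ℤ} {α : I → V} {coroot : I → (V →ₗ[ℚ] ℚ)} {lam μ ν ξ β : V}
  {βv : V →ₗ[ℚ] ℚ} {n : ℕ} {i : I} {a : ℚ}

lemma HasChain.refl (h : μ ∈ Torbit α coroot lam) : HasChain A α coroot lam 0 μ μ :=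
  ⟨fun _ => μ, fun _ => 0, fun _ => 0, rfl, rfl, fun _ _ => h, by simp⟩

lemma HasChain.eq_of_zero (h : HasChain A α coroot lam 0 μ ν) : μ = ν := by
  obtain ⟨c, β, βv, h1, h2, -⟩ := h
  exact h1.symm.trans h2

lemma HasChain.cons (h : ChainStep A α coroot lam ξ μ β βv) (h' : HasChain A α coroot lam n μ ν) :
    HasChain A α coroot lam (n + 1) ξ ν := by
  obtain ⟨c, γ, γv, h1, h2, h3, h4⟩ := h'
  refine ⟨fun k => Nat.casesOn k ξ c, fun k => Nat.casesOn k β γ,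
    fun k => Nat.casesOn k βv γv, rfl, h2, ?_, ?_⟩
  · rintro (_ | k) hk
    · exact h.left_mem
    · exact h3 k (by omega)
  · rintro (_ | k) hk
    · simp only [h1]
      exact ⟨h.isRoot, h.mem_Qplus, h.pos, h.eq⟩
    · exact h4 k (by omega)

lemma IsChain.tail {c γ : ℕ → V} {γv : ℕ → (V →ₗ[ℚ] ℚ)}
    (h : IsChain A α coroot lam μ ν (n + 1) c γ γv) :
    ChainStep A α coroot lam μ (c 1) (γ 0) (γv 0) ∧
    IsChain A α coroot lam (c 1) ν n (fun k => c (k + 1)) (fun k => γ (k + 1))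
      (fun k => γv (k + 1)) := by
  obtain ⟨h1, h2, h3, h4⟩ := h
  have h0 := h4 0 (by omega)
  simp only [zero_add, h1] at h0
  exact ⟨⟨h1 ▸ h3 0 (by omega), h3 1 (by omega), h0.1, h0.2.1, h0.2.2.1, h0.2.2.2⟩, rfl, h2,
    fun k hk => h3 (k + 1) (by omega), fun k hk => h4 (k + 1) (by omega)⟩

lemma HasChain.uncons (h : HasChain A α coroot lam (n + 1) ξ ν) :
    ∃ μ β βv, ChainStep A α coroot lam ξ μ β βv ∧ HasChain A α coroot lam n μ ν := by
  obtain ⟨c, γ, γv, h⟩ := h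
  exact ⟨_, _, _, h.tail.1, _, _, _, h.tail.2⟩

lemma ChainStep.hasChain (h : ChainStep A α coroot lam μ ν β βv) :
    HasChain A α coroot lam 1 μ ν :=
  HasChain.cons h (HasChain.refl h.right_mem)

lemma hasAChain_iff :
    HasAChain A α coroot lam a μ ν ↔ Relation.TransGen (AStep A α coroot lam a) μ ν := by
  constructor
  · rintro ⟨s, c, β, βv, ks, hs, hc, h⟩
    obtain ⟨n, rfl⟩ := Nat.exists_eq_add_of_le' hs
    induction n generalizing μ c β βv ks with
    | zero =>
      obtain ⟨h1, h2, -⟩ := hc.tail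
      have hν : c 1 = ν := h2 ▸ hc.2.1
      have h0 := h 0 (by omega)
      simp only [zero_add, hc.1, hν] at h0
      exact .single ⟨_, _, _, h0.1, hν ▸ h1, h0.2⟩
    | succ n ih =>
      obtain ⟨h1, h2⟩ := hc.tail
      have h0 := h 0 (by omega)
      simp only [zero_add, hc.1] at h0
      exact .head ⟨_, _, _, h0.1, h1, h0.2⟩
        (ih (fun k => c (k + 1)) (fun k => β (k + 1)) (fun k => βv (k + 1))
          (fun k => ks (k + 1)) (by omega) h2 fun k hk => h (k + 1) (by omega))
  · intro h
    induction h using Relation.TransGen.head_induction_on with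
    | @single x h =>
      obtain ⟨β, βv, k, h1, h2, h3⟩ := h
      refine ⟨1, fun k => Nat.casesOn k x fun _ => ν, fun _ => β, fun _ => βv, fun _ => k,
        le_rfl, ⟨rfl, rfl, ?_, ?_⟩, ?_⟩
      · rintro (_ | k) hk
        · exact h2.left_mem
        · exact h2.right_mem
      · intro k hk
        obtain rfl : k = 0 := by omega
        exact ⟨h2.isRoot, h2.mem_Qplus, h2.pos, h2.eq⟩
      · intro k hk
        obtain rfl : k = 0 := by omega
        exact ⟨h1, h3⟩
    | @head x y h _ ih =>
      obtain ⟨β, βv, k, h1, h2, h3⟩ := h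
      obtain ⟨s, c, γ, γv, ks, hs, ⟨e1, e2, e3, e4⟩, e5⟩ := ih
      refine ⟨s + 1, fun k => Nat.casesOn k x c, fun k => Nat.casesOn k β γ,
        fun k => Nat.casesOn k βv γv, fun j => Nat.casesOn j k ks, by omega,
        ⟨rfl, e2, ?_, ?_⟩, ?_⟩
      · rintro (_ | k) hk
        · exact h2.left_mem
        · exact e3 k (by omega)
      · rintro (_ | k) hk
        · simp only [e1]
          exact ⟨h2.isRoot, h2.mem_Qplus, h2.pos, h2.eq⟩
        · exact e4 k (by omega)
      · rintro (_ | k) hk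
        · simp only [e1]
          exact ⟨h1, h3⟩
        · exact e5 k (by omega)

lemma srefl_mem_Torbit (i : I) (h : μ ∈ Torbit α coroot lam) :
    srefl α coroot i μ ∈ Torbit α coroot lam := by
  obtain ⟨τ, hτ, rfl⟩ := h
  exact ⟨srefl α coroot i * τ, mul_mem (Submonoid.subset_closure ⟨i, rfl⟩) hτ, rfl⟩

namespace IsRealization

variable (hD : IsRealization A α coroot)
include hD

lemma chainStep_srefl (hi : A i i = 2) (h : ChainStep A α coroot lam μ ν β βv)
    (hβ : srefl α coroot i β ∈ Qplus α) :
    ChainStep A α coroot lam (srefl α coroot i μ) (srefl α coroot i ν) (srefl α coroot i β)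
      (crefl α coroot i βv) where
  left_mem := srefl_mem_Torbit i h.left_mem
  right_mem := srefl_mem_Torbit i h.right_mem
  isRoot := let ⟨l, k, hp⟩ := h.isRoot; ⟨i :: l, k, hp.cons hi⟩
  mem_Qplus := hβ
  pos := by rw [crefl_apply, hD.srefl_srefl hi]; exact h.pos
  eq := by rw [crefl_apply, hD.srefl_srefl hi, h.eq, map_sub, map_smul]

omit hD in
lemma isWRootPres_simple (i : I) : IsWRootPres A α coroot [] i (α i) (coroot i) :=
  ⟨by simp, by simp, by simp⟩

omit hD in
lemma chainStep_simple (h : ν ∈ Torbit α coroot lam) (hpos : 0 < coroot i ν) :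
    ChainStep A α coroot lam (srefl α coroot i ν) ν (α i) (coroot i) where
  left_mem := srefl_mem_Torbit i h
  right_mem := h
  isRoot := ⟨[], i, isWRootPres_simple i⟩
  mem_Qplus := mem_Qplus_iff.2 ⟨Finsupp.single i 1, by simp, by simp⟩
  pos := hpos
  eq := rfl

/-- The reverse of `chainStep_simple`, starting from a weight with negative pairing. -/
lemma chainStep_simple' (hi : A i i = 2) (h : ν ∈ Torbit α coroot lam)
    (hneg : coroot i ν < 0) :
    ChainStep A α coroot lam ν (srefl α coroot i ν) (α i) (coroot i) := by
  have := chainStep_simple (A := A) (i := i) (srefl_mem_Torbit i h)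
    (by rw [hD.coroot_srefl hi]; linarith)
  rwa [hD.srefl_srefl hi] at this

/-- Either a step is the simple reflection `r_i`, or it can be conjugated by `r_i`. -/
lemma chainStep_cases (hi : A i i = 2) (h : ChainStep A α coroot lam μ ν β βv) :
    (μ = srefl α coroot i ν ∧ 0 < coroot i ν) ∨
    ∃ γ γv, ChainStep A α coroot lam (srefl α coroot i μ) (srefl α coroot i ν) γ γv := by
  obtain ⟨l, k, hp⟩ := h.isRoot
  rcases hD.srefl_mem_Qplus_or hp h.mem_Qplus hi with ⟨-, rfl, rfl⟩ | h'
  · exact Or.inl ⟨h.eq, h.pos⟩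
  · exact Or.inr ⟨_, _, hD.chainStep_srefl hi h h'⟩

omit hD in
lemma hasChain_sub {n : ℕ} (h : HasChain A α coroot lam n μ ν) :
    ∃ c : I →₀ ℚ, 0 ≤ c ∧ ν - μ = Finsupp.linearCombination ℚ α c := by
  induction n generalizing μ with
  | zero => exact ⟨0, le_rfl, by simp [h.eq_of_zero]⟩
  | succ n ih =>
    obtain ⟨ξ, β, βv, h1, h2⟩ := h.uncons
    obtain ⟨c, hc, hc'⟩ := ih h2
    obtain ⟨d, hd⟩ := h1.mem_Qplus
    refine ⟨c + βv ξ • d.mapRange (Nat.cast : ℕ → ℚ) (by simp),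
      add_nonneg hc (smul_nonneg h1.pos.le fun i => by simp), ?_⟩
    rw [map_add, map_smul, ← hc', Finsupp.linearCombination_apply,
      Finsupp.sum_mapRange_index (by simp), ← hd, h1.eq]
    module

/-- A chain between two weights differing by a multiple of `α_i` starts with `r_i`. -/
lemma chainStep_of_sub_eq_smul (hi : A i i = 2) (h : ChainStep A α coroot lam ξ μ β βv)
    (h' : HasChain A α coroot lam n μ ν) {x : ℚ} (hx : ν - ξ = x • α i) :
    ξ = srefl α coroot i μ ∧ 0 < coroot i μ ∧ ∃ y : ℚ, ν - μ = y • α i := by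
  obtain ⟨c, hc, hc'⟩ := hasChain_sub h'
  obtain ⟨d, hd, hd'⟩ := hasChain_sub h.hasChain
  have hsum : c + d = Finsupp.single i x := by
    apply hD.linearIndependent
    rw [map_add, ← hc', ← hd', Finsupp.linearCombination_single, ← hx]
    abel
  have hsupp : ∀ e : I →₀ ℚ, 0 ≤ e → e ≤ c + d → e = Finsupp.single i (e i) := by
    classical
    intro e he hle
    ext j
    by_cases hj : i = j
    · simp [hj]
    · have h1 := he j
      have h2 := hle j
      rw [hsum] at h2
      simp only [Finsupp.single_apply, hj, if_false, Finsupp.coe_zero, Pi.zero_apply] at h1 h2 ⊢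
      exact le_antisymm h2 h1
  have hc2 := hsupp c hc (le_add_of_nonneg_right hd)
  have hd2 := hsupp d hd (le_add_of_nonneg_left hc)
  rw [hc2, Finsupp.linearCombination_single] at hc'
  rw [hd2, Finsupp.linearCombination_single, h.eq, sub_sub_cancel] at hd'
  obtain ⟨l, k, hp⟩ := h.isRoot
  obtain ⟨rfl, rfl⟩ := hD.eq_simple_of_smul hp h.mem_Qplus hi (x := (βv μ)⁻¹ * d i) (by
    rw [mul_smul, ← hd', smul_smul, inv_mul_cancel₀ h.pos.ne', one_smul])
  exact ⟨h.eq, h.pos, _, hc'⟩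

lemma hasChain_length_le_one (hi : A i i = 2) (h : HasChain A α coroot lam n μ ν) {x : ℚ}
    (hx : ν - μ = x • α i) : n ≤ 1 := by
  by_contra! hn
  obtain ⟨m, rfl⟩ := Nat.exists_eq_add_of_le' hn
  obtain ⟨ξ, β, βv, h1, h2⟩ := HasChain.uncons (n := m + 1) h
  obtain ⟨-, h3, y, hy⟩ := hD.chainStep_of_sub_eq_smul hi h1 h2 hx
  obtain ⟨ζ, β', βv', h4, h5⟩ := h2.uncons
  obtain ⟨h6, h7, -⟩ := hD.chainStep_of_sub_eq_smul hi h4 h5 hy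
  rw [h6, hD.coroot_srefl hi] at h3
  linarith

lemma distEq_simple (hi : A i i = 2) (h : ν ∈ Torbit α coroot lam) (hpos : 0 < coroot i ν) :
    distEq A α coroot lam (srefl α coroot i ν) ν 1 :=
  ⟨(chainStep_simple h hpos).hasChain, fun _ c β βv hc =>
    hD.hasChain_length_le_one hi ⟨c, β, βv, hc⟩ (x := coroot i ν) (by
      rw [srefl_apply, sub_sub_cancel])⟩

end IsRealization

open Classical in
/-- The element of `{μ, r_i μ}` with nonnegative pairing with the coroot of `i`. -/
noncomputable def lowerRefl (α : I → V) (coroot : I → (V →ₗ[ℚ] ℚ)) (i : I) (μ : V) : V :=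
  if coroot i μ < 0 then srefl α coroot i μ else μ

open Classical in
/-- The element of `{μ, r_i μ}` with nonpositive pairing with the coroot of `i`. -/
noncomputable def upperRefl (α : I → V) (coroot : I → (V →ₗ[ℚ] ℚ)) (i : I) (μ : V) : V :=
  if 0 < coroot i μ then srefl α coroot i μ else μ

end Chains
end GKM

namespace GKM

section Lifting

variable {I V : Type*} [AddCommGroup V] [Module ℚ V]
variable {A : I → I → ℤ} {α : I → V} {coroot : I → (V →ₗ[ℚ] ℚ)} {lam μ ν ξ β : V}
  {βv : V →ₗ[ℚ] ℚ} {n : ℕ} {i : I} {a : ℚ}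

lemma srefl_of_coroot_eq_zero (h : coroot i μ = 0) : srefl α coroot i μ = μ := by
  rw [srefl_apply, h, zero_smul, sub_zero]

lemma lowerRefl_of_neg (h : coroot i μ < 0) : lowerRefl α coroot i μ = srefl α coroot i μ :=
  if_pos h

lemma lowerRefl_of_nonneg (h : 0 ≤ coroot i μ) : lowerRefl α coroot i μ = μ :=
  if_neg h.not_gt

lemma upperRefl_of_pos (h : 0 < coroot i μ) : upperRefl α coroot i μ = srefl α coroot i μ :=
  if_pos h

lemma upperRefl_of_nonpos (h : coroot i μ ≤ 0) : upperRefl α coroot i μ = μ :=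
  if_neg h.not_gt

namespace IsRealization

variable (hD : IsRealization A α coroot)
include hD

/-- A chain ending in a weight with negative pairing can be folded onto the nonnegative side of
the hyperplane of `r_i` without becoming too short. -/
lemma exists_hasChain_lowerRefl (hi : A i i = 2) (h : HasChain A α coroot lam n μ ν)
    (hν : coroot i ν < 0) :
    ∃ N, HasChain A α coroot lam N (lowerRefl α coroot i μ) (lowerRefl α coroot i ν) ∧
      min n 2 ≤ N ∧ (0 < coroot i μ → 2 ≤ N) := by
  induction n generalizing μ with
  | zero =>
    obtain rfl := h.eq_of_zero
    obtain ⟨c, γ, γv, h1, h2, h3, -⟩ := h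
    refine ⟨0, HasChain.refl ?_, by simp, fun h' => absurd h' hν.not_gt⟩
    rw [lowerRefl_of_neg hν]
    exact srefl_mem_Torbit i (h1 ▸ h3 0 le_rfl)
  | succ n ih =>
    obtain ⟨ξ, β, βv, h1, h2⟩ := h.uncons
    obtain ⟨N, hN, hN1, hN2⟩ := ih h2
    rcases hD.chainStep_cases hi h1 with ⟨rfl, hξ⟩ | ⟨γ, γv, hc⟩
    · have hneg : coroot i (srefl α coroot i ξ) < 0 := by rw [hD.coroot_srefl hi]; linarith
      refine ⟨N, ?_, (min_le_right _ _).trans (hN2 hξ), fun h' => absurd h' hneg.not_gt⟩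
      rwa [lowerRefl_of_neg hneg, hD.srefl_srefl hi, ← lowerRefl_of_nonneg (α := α) hξ.le]
    · rcases lt_or_ge (coroot i μ) 0 with hμ | hμ
      · rw [lowerRefl_of_neg hμ]
        rcases lt_trichotomy (coroot i ξ) 0 with hξ | hξ | hξ
        · rw [lowerRefl_of_neg hξ] at hN
          exact ⟨N + 1, hN.cons hc, by omega, fun h' => absurd h' hμ.not_gt⟩
        · rw [lowerRefl_of_nonneg hξ.ge] at hN
          rw [srefl_of_coroot_eq_zero hξ] at hc
          exact ⟨N + 1, hN.cons hc, by omega, fun h' => absurd h' hμ.not_gt⟩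
        · rw [lowerRefl_of_nonneg hξ.le] at hN
          exact ⟨N + 2, (hN.cons (chainStep_simple h1.right_mem hξ)).cons hc, by omega,
            fun _ => by omega⟩
      · rw [lowerRefl_of_nonneg hμ]
        rcases lt_or_ge (coroot i ξ) 0 with hξ | hξ
        · rw [lowerRefl_of_neg hξ] at hN
          exact ⟨N + 2, (hN.cons (hD.chainStep_simple' hi h1.right_mem hξ)).cons h1, by omega,
            fun _ => by omega⟩
        · rw [lowerRefl_of_nonneg hξ] at hN
          have hn : n ≠ 0 := by
            rintro rfl
            rw [h2.eq_of_zero] at hξ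
            exact hξ.not_gt hν
          exact ⟨N + 1, hN.cons h1, by omega, fun _ => by omega⟩

lemma distEq_srefl (hi : A i i = 2) (h : ChainStep A α coroot lam μ ν β βv)
    (hd : distEq A α coroot lam μ ν 1) (hμ : 0 < coroot i μ) (hν : 0 < coroot i ν) :
    distEq A α coroot lam (srefl α coroot i μ) (srefl α coroot i ν) 1 := by
  constructor
  · rcases hD.chainStep_cases hi h with ⟨rfl, hξ⟩ | ⟨γ, γv, hc⟩
    · rw [hD.coroot_srefl hi] at hμ
      linarith
    · exact hc.hasChain
  · intro m c γ γv hc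
    have hμ' : coroot i (srefl α coroot i μ) < 0 := by rw [hD.coroot_srefl hi]; linarith
    have hν' : coroot i (srefl α coroot i ν) < 0 := by rw [hD.coroot_srefl hi]; linarith
    obtain ⟨N, ⟨c', γ', γv', hN⟩, hN1, -⟩ :=
      hD.exists_hasChain_lowerRefl hi ⟨c, γ, γv, hc⟩ hν'
    rw [lowerRefl_of_neg hμ', lowerRefl_of_neg hν', hD.srefl_srefl hi, hD.srefl_srefl hi] at hN
    have := hd.2 _ _ _ _ hN
    omega

lemma aStep_simple (hi : A i i = 2) (h : ν ∈ Torbit α coroot lam) (ha : 0 < a)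
    (hpos : 0 < coroot i ν) (hint : ∃ m : ℤ, a * coroot i ν = m) :
    AStep A α coroot lam a (srefl α coroot i ν) ν := by
  refine ⟨α i, coroot i, i, ⟨[], isWRootPres_simple i⟩, chainStep_simple h hpos,
    hD.distEq_simple hi h hpos, fun _ => ?_, fun h' => absurd hi h'⟩
  obtain ⟨m, hm⟩ := hint
  have hm0 : (0 : ℚ) < m := hm ▸ mul_pos ha hpos
  lift m to ℕ using (by exact_mod_cast hm0.le)
  exact ⟨m, by exact_mod_cast hm0, by simpa using hm⟩

omit hD in
lemma aStep_integral (h : AStep A α coroot lam a μ ν) :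
    ∃ β βv, ChainStep A α coroot lam μ ν β βv ∧ ∃ m : ℤ, a * βv ν = m := by
  obtain ⟨β, βv, k, -, h2, -, h4, h5⟩ := h
  refine ⟨β, βv, h2, ?_⟩
  by_cases hk : A k k = 2
  · obtain ⟨m, -, hm⟩ := h4 hk
    exact ⟨m, by simpa using hm⟩
  · exact ⟨1, by simpa using h5 hk⟩

lemma aStep_sub_integral (j : I) (h : AStep A α coroot lam a μ ν) :
    ∃ m : ℤ, a * coroot j μ - a * coroot j ν = m := by
  obtain ⟨β, βv, h1, m, hm⟩ := aStep_integral h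
  obtain ⟨n, hn⟩ := hD.coroot_int_of_mem_Qplus h1.mem_Qplus j
  refine ⟨-(m * n), ?_⟩
  rw [h1.eq, map_sub, map_smul, smul_eq_mul, hn]
  push_cast
  rw [← hm]
  ring

lemma reflTransGen_sub_integral (j : I)
    (h : Relation.ReflTransGen (AStep A α coroot lam a) μ ν) :
    ∃ m : ℤ, a * coroot j μ - a * coroot j ν = m := by
  induction h with
  | refl => exact ⟨0, by simp⟩
  | tail _ h ih =>
    obtain ⟨m, hm⟩ := ih
    obtain ⟨n, hn⟩ := hD.aStep_sub_integral j h
    exact ⟨m + n, by push_cast; rw [← hm, ← hn]; ring⟩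

/-- Either a step of an `a`-chain is the reflection `r_i`, or it can be conjugated by `r_i`. -/
lemma aStep_cases (hi : A i i = 2) (h : AStep A α coroot lam a μ ν) :
    (μ = srefl α coroot i ν ∧ 0 < coroot i ν ∧ ∃ m : ℤ, a * coroot i ν = m) ∨
    (∃ γ γv, ChainStep A α coroot lam (srefl α coroot i μ) (srefl α coroot i ν) γ γv) ∧
      (0 < coroot i μ → 0 < coroot i ν →
        AStep A α coroot lam a (srefl α coroot i μ) (srefl α coroot i ν)) := by
  obtain ⟨β, βv, k, ⟨l, hp⟩, h2, h3, h4, h5⟩ := h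
  rcases hD.srefl_mem_Qplus_or hp h2.mem_Qplus hi with ⟨hk, rfl, rfl⟩ | h'
  · obtain ⟨m, -, hm⟩ := h4 hk
    exact Or.inl ⟨h2.eq, h2.pos, m, by simpa using hm⟩
  · have hc := hD.chainStep_srefl hi h2 h'
    refine Or.inr ⟨⟨_, _, hc⟩, fun hμ hν => ⟨_, _, k, ⟨_, hp.cons hi⟩, hc,
      hD.distEq_srefl hi h2 h3 hμ hν, ?_⟩⟩
    rw [crefl_apply, hD.srefl_srefl hi]
    exact ⟨h4, h5⟩

/-- A covering other than `r_i` cannot go from the positive to the nonpositive side. -/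
lemma pos_of_distEq (hi : A i i = 2) (h : ChainStep A α coroot lam μ ν β βv)
    (hd : distEq A α coroot lam μ ν 1) {γ : V} {γv : V →ₗ[ℚ] ℚ}
    (hc : ChainStep A α coroot lam (srefl α coroot i μ) (srefl α coroot i ν) γ γv)
    (hν : 0 < coroot i ν) : 0 < coroot i μ := by
  by_contra! hμ
  have h1 := ((HasChain.refl h.right_mem).cons (chainStep_simple h.right_mem hν)).cons hc
  rcases hμ.lt_or_eq with hμ | hμ
  · obtain ⟨_, _, _, hch⟩ := h1.cons (hD.chainStep_simple' hi h.left_mem hμ)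
    have := hd.2 _ _ _ _ hch
    omega
  · rw [srefl_of_coroot_eq_zero hμ] at h1
    obtain ⟨_, _, _, hch⟩ := h1
    have := hd.2 _ _ _ _ hch
    omega

/-- `a`-chains can be folded onto the nonpositive side of the hyperplane of `r_i`. -/
lemma reflTransGen_upperRefl (hi : A i i = 2) (ha : 0 < a)
    (h : Relation.ReflTransGen (AStep A α coroot lam a) μ ν)
    (hν : 0 < coroot i ν ∨ ∃ m : ℤ, a * coroot i ν = m) :
    (0 < coroot i μ ∨ ∃ m : ℤ, a * coroot i μ = m) ∧
      Relation.ReflTransGen (AStep A α coroot lam a) (upperRefl α coroot i μ)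
        (upperRefl α coroot i ν) := by
  induction h using Relation.ReflTransGen.head_induction_on with
  | refl => exact ⟨hν, .refl⟩
  | @head μ ξ h _ ih =>
    obtain ⟨hξ, ih⟩ := ih
    rcases hD.aStep_cases hi h with ⟨rfl, hpos, m, hm⟩ | ⟨⟨γ, γv, hc⟩, hstep⟩
    · refine ⟨Or.inr ⟨-m, ?_⟩, ?_⟩
      · rw [hD.coroot_srefl hi]
        push_cast
        rw [← hm]
        ring
      · rw [upperRefl_of_pos hpos] at ih
        rwa [upperRefl_of_nonpos]
        rw [hD.coroot_srefl hi]
        linarith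
    · obtain ⟨β, βv, k, h1, h2, h3, h4⟩ := id h
      rcases lt_or_ge 0 (coroot i ξ) with hξ' | hξ'
      · have hμ := hD.pos_of_distEq hi h2 h3 hc hξ'
        refine ⟨Or.inl hμ, ?_⟩
        rw [upperRefl_of_pos hξ'] at ih
        rw [upperRefl_of_pos hμ]
        exact ih.head (hstep hμ hξ')
      · obtain ⟨m, hm⟩ := hξ.resolve_left hξ'.not_gt
        obtain ⟨n, hn⟩ := hD.aStep_sub_integral i h
        have hint : ∃ m : ℤ, a * coroot i μ = m :=
          ⟨n + m, by push_cast; rw [← hm, ← hn]; ring⟩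
        refine ⟨Or.inr hint, ?_⟩
        rw [upperRefl_of_nonpos hξ'] at ih
        rcases lt_or_ge 0 (coroot i μ) with hμ | hμ
        · rw [upperRefl_of_pos hμ]
          exact (ih.head h).head (hD.aStep_simple hi h2.left_mem ha hμ hint)
        · rw [upperRefl_of_nonpos hμ]
          exact ih.head h

end IsRealization

end Lifting
end GKM

namespace GKM

section Paths

variable {I V : Type*} [AddCommGroup V] [Module ℚ V]
variable {A : I → I → ℤ} {α : I → V} {coroot : I → (V →ₗ[ℚ] ℚ)} {lam : V}
  {l l' : ℕ → V} {a a' : ℕ → ℚ} {s : ℕ}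

/-- Data as for a generalized Lakshmibai–Seshadri path, with repetitions of weights and of
breakpoints allowed, and with `lam` appended as the last weight. -/
structure WeakGLS (A : I → I → ℤ) (α : I → V) (coroot : I → (V →ₗ[ℚ] ℚ)) (lam : V) (s : ℕ)
    (l : ℕ → V) (a : ℕ → ℚ) : Prop where
  one_le : 1 ≤ s
  zero : a 0 = 0
  one : a s = 1
  le_succ : ∀ k < s, a k ≤ a (k + 1)
  mem : ∀ k, 1 ≤ k → k ≤ s → l k ∈ Torbit α coroot lam
  chain : ∀ k, 1 ≤ k → k ≤ s → Relation.ReflTransGen (AStep A α coroot lam (a k)) (l k) (l (k + 1))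
  last : l (s + 1) = lam

lemma le_of_le_succ (h : ∀ k < s, a k ≤ a (k + 1)) {j k : ℕ} (hjk : j ≤ k) (hk : k ≤ s) :
    a j ≤ a k := by
  induction k, hjk using Nat.le_induction with
  | base => exact le_rfl
  | succ k _ ih => exact (ih (by omega)).trans (h k (by omega))

lemma glsPath_zero (h : ∀ k < s, a k ≤ a (k + 1)) (h0 : a 0 = 0) : glsPath l a s 0 = 0 := by
  refine Finset.sum_eq_zero fun k hk => ?_
  rw [Finset.mem_range] at hk
  have := le_of_le_succ h (Nat.zero_le k) hk.le
  rw [max_eq_right, zero_smul]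
  have := min_le_left 0 (a (k + 1))
  linarith

lemma glsPath_segment (h : ∀ k < s, a k ≤ a (k + 1)) {j : ℕ} (hj : j < s) {t : ℚ}
    (h1 : a j ≤ t) (h2 : t ≤ a (j + 1)) :
    glsPath l a s t = glsPath l a s (a j) + (t - a j) • l (j + 1) := by
  rw [← sub_eq_iff_eq_add', glsPath, glsPath, ← Finset.sum_sub_distrib,
    Finset.sum_eq_single_of_mem j (Finset.mem_range.2 hj), ← sub_smul]
  · rw [min_eq_left h2, min_eq_left (h j hj), sub_self, max_self, sub_zero,
      max_eq_left (sub_nonneg.2 h1)]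
  · intro k hk hkj
    rw [Finset.mem_range] at hk
    rw [← sub_smul]
    convert zero_smul ℚ (l (k + 1))
    rcases lt_or_gt_of_ne hkj with hkj | hkj
    · have := le_of_le_succ h (show k + 1 ≤ j from hkj) hj.le
      rw [min_eq_right (this.trans h1), min_eq_right this, sub_self]
    · have := le_of_le_succ h (show j + 1 ≤ k from hkj) hk.le
      rw [max_eq_right, max_eq_right, sub_self]
      · linarith [min_le_left (a j) (a (k + 1))]
      · linarith [min_le_left t (a (k + 1))]

lemma exists_segment {t : ℚ} {n : ℕ} (h0 : a 0 < t) (hn : t ≤ a n) :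
    ∃ j < n, a j < t ∧ t ≤ a (j + 1) := by
  induction n with
  | zero => exact absurd h0 hn.not_gt
  | succ n ih =>
    rcases lt_or_ge (a n) t with h | h
    · exact ⟨n, by omega, h, hn⟩
    · obtain ⟨j, hj, h⟩ := ih h
      exact ⟨j, by omega, h⟩

/-- A path is determined by its starting point and its directions. -/
lemma eq_glsPath_of_segment (h : ∀ k < s, a k ≤ a (k + 1)) (h0 : a 0 = 0) {F : ℚ → V}
    (hF0 : F 0 = 0)
    (hF : ∀ j < s, ∀ t, a j ≤ t → t ≤ a (j + 1) → F t = F (a j) + (t - a j) • l (j + 1))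
    {t : ℚ} (ht0 : 0 ≤ t) (ht : t ≤ a s) : F t = glsPath l a s t := by
  have key : ∀ j ≤ s, F (a j) = glsPath l a s (a j) := by
    intro j hj
    induction j with
    | zero => rw [h0, hF0, glsPath_zero h h0]
    | succ j ih =>
      rw [hF j hj _ (h j hj) le_rfl, glsPath_segment h hj (h j hj) le_rfl, ih (by omega)]
  rcases ht0.eq_or_lt with rfl | ht0
  · rw [hF0, glsPath_zero h h0]
  · obtain ⟨j, hj, h1, h2⟩ := exists_segment (h0.trans_lt ht0) ht
    rw [hF j hj t h1.le h2, glsPath_segment h hj h1.le h2, key j hj.le]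

lemma glsPath_congr (hl : ∀ k, 1 ≤ k → k ≤ s → l k = l' k) (t : ℚ) :
    glsPath l a s t = glsPath l' a s t :=
  Finset.sum_congr rfl fun k hk => by
    rw [hl (k + 1) (by omega) (Finset.mem_range.1 hk)]

lemma IsGLS.weakGLS (h : IsGLS A α coroot lam s l a) :
    WeakGLS A α coroot lam s (Function.update l (s + 1) lam) a := by
  obtain ⟨h1, h2, h3, h4, h5, h6, h7⟩ := h
  have hl : ∀ k ≤ s, Function.update l (s + 1) lam k = l k := fun k hk =>
    Function.update_of_ne (by omega) _ _
  refine ⟨h1, h2, h3, fun k hk => (h4 k hk).le, fun k hk hk' => ?_, fun k hk hk' => ?_, ?_⟩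
  · rw [hl k hk']
    exact h5 k hk hk'
  · rw [hl k hk']
    rcases hk'.eq_or_lt with rfl | hk'
    · rw [Function.update_self, h3]
      rcases h7 with h7 | h7
      · rw [h7]
      · exact (hasAChain_iff.1 h7).to_reflTransGen
    · rw [hl (k + 1) hk']
      exact (hasAChain_iff.1 (h6 k hk hk')).to_reflTransGen
  · exact Function.update_self ..

lemma WeakGLS.isGLS (h : WeakGLS A α coroot lam s l a) (ha : ∀ k < s, a k ≠ a (k + 1))
    (hl : ∀ k, 1 ≤ k → k < s → l k ≠ l (k + 1)) : IsGLS A α coroot lam s l a := by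
  refine ⟨h.one_le, h.zero, h.one, fun k hk => (h.le_succ k hk).lt_of_ne (ha k hk), h.mem,
    fun k hk hk' => hasAChain_iff.2 ?_, ?_⟩
  · exact (Relation.reflTransGen_iff_eq_or_transGen.1 (h.chain k hk hk'.le)).resolve_left
      (hl k hk hk').symm
  · have := h.chain s h.one_le le_rfl
    rw [h.last, h.one, Relation.reflTransGen_iff_eq_or_transGen] at this
    exact this.imp Eq.symm hasAChain_iff.2

/-- Dropping the `k`-th breakpoint and the weight following it. -/
lemma WeakGLS.drop (h : WeakGLS A α coroot lam (s + 1) l a) {k : ℕ} (hk : k ≤ s) (hs : 1 ≤ s)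
    (hrep : a k = a (k + 1) ∨ 1 ≤ k ∧ l k = l (k + 1)) :
    WeakGLS A α coroot lam s (fun j => if j ≤ k then l j else l (j + 1))
      (fun j => if j < k then a j else a (j + 1)) where
  one_le := hs
  zero := by
    rcases Nat.eq_zero_or_pos k with rfl | hk
    · rcases hrep with h' | h'
      · simp [← h', h.zero]
      · omega
    · simp [hk, h.zero]
  one := by simp [hk.not_gt, h.one]
  le_succ j hj := by
    have h1 := h.le_succ j (by omega)
    have h2 := h.le_succ (j + 1) (by omega)
    split_ifs <;> first | omega | linarith
  mem j h1 h2 := by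
    split_ifs
    · exact h.mem j h1 (by omega)
    · exact h.mem (j + 1) (by omega) (by omega)
  chain j h1 h2 := by
    rcases lt_trichotomy j k with hj | rfl | hj
    · rw [if_pos hj, if_pos hj.le, if_pos (by omega)]
      exact h.chain j h1 (by omega)
    · rw [if_neg (lt_irrefl j), if_pos le_rfl, if_neg (by omega)]
      rcases hrep with h' | ⟨-, h'⟩
      · have := h.chain j h1 (by omega)
        rw [h'] at this
        exact this.trans (h.chain (j + 1) (by omega) (by omega))
      · rw [h']
        exact h.chain (j + 1) (by omega) (by omega)
    · rw [if_neg hj.not_gt, if_neg hj.not_ge, if_neg (by omega)]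
      exact h.chain (j + 1) (by omega) (by omega)
  last := by
    rw [if_neg (by omega)]
    exact h.last

lemma WeakGLS.glsPath_drop (h : WeakGLS A α coroot lam (s + 1) l a) {k : ℕ} (hk : k ≤ s)
    (hs : 1 ≤ s) (hrep : a k = a (k + 1) ∨ 1 ≤ k ∧ l k = l (k + 1)) :
    pathEq (glsPath l a (s + 1)) (glsPath (fun j => if j ≤ k then l j else l (j + 1))
      (fun j => if j < k then a j else a (j + 1)) s) := by
  intro t ht0 ht1
  have h' := h.drop hk hs hrep
  refine eq_glsPath_of_segment h'.le_succ h'.zero (glsPath_zero h.le_succ h.zero) ?_ ht0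
    (ht1.trans_eq h'.one.symm)
  intro j hj t ht1 ht2
  rcases lt_trichotomy (j + 1) k with hj' | rfl | hj'
  · rw [if_pos (by omega)] at ht1 ht2 ⊢
    rw [if_pos (by omega)]
    exact glsPath_segment h.le_succ (by omega) ht1 ht2
  · rw [if_pos (by omega)] at ht1 ⊢
    rw [if_neg (by omega)] at ht2
    rw [if_pos le_rfl]
    have h3 := h.le_succ j (by omega)
    have h4 := h.le_succ (j + 1) (by omega)
    rcases le_total t (a (j + 1)) with ht | ht
    · exact glsPath_segment h.le_succ (by omega) ht1 ht
    · rw [glsPath_segment (j := j + 1) h.le_succ (by omega) ht ht2,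
        glsPath_segment (j := j) h.le_succ (by omega) h3 le_rfl]
      rcases hrep with h' | ⟨-, h'⟩
      · have : t = a (j + 1) := le_antisymm (ht2.trans_eq h'.symm) ht
        rw [this]
        module
      · rw [h']
        module
  · rw [if_neg (by omega)] at ht1 ht2 ⊢
    rw [if_neg (by omega)]
    exact glsPath_segment h.le_succ (by omega) ht1 ht2

lemma WeakGLS.exists_mem_GLSset (h : WeakGLS A α coroot lam s l a) :
    ∃ ρ ∈ GLSset A α coroot lam, pathEq (glsPath l a s) ρ := by
  induction s generalizing l a with
  | zero => exact absurd h.one_le (by simp)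
  | succ s ih =>
    by_cases hrep : ∃ k ≤ s, a k = a (k + 1) ∨ 1 ≤ k ∧ l k = l (k + 1)
    · obtain ⟨k, hk, hrep⟩ := hrep
      rcases Nat.eq_zero_or_pos s with rfl | hs
      · obtain rfl : k = 0 := by omega
        rcases hrep with h' | h'
        · rw [h.zero, h.one] at h'
          norm_num at h'
        · omega
      · obtain ⟨ρ, hρ, hρ'⟩ := ih (h.drop hk hs hrep)
        exact ⟨ρ, hρ, fun t h0 h1 => (h.glsPath_drop hk hs hrep t h0 h1).trans (hρ' t h0 h1)⟩
    · push Not at hrep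
      exact ⟨_, ⟨_, _, _, h.isGLS (fun k hk => (hrep k (by omega)).1)
        (fun k hk hk' => (hrep k (by omega)).2 hk), rfl⟩, fun _ _ _ => rfl⟩

end Paths
end GKM

namespace GKM

section Slopes

variable {I V : Type*} [AddCommGroup V] [Module ℚ V]
variable {A : I → I → ℤ} {α : I → V} {coroot : I → (V →ₗ[ℚ] ℚ)} {lam : V}
  {l : ℕ → V} {a : ℕ → ℚ} {s : ℕ} {i : I} {t : ℚ}

lemma hFun_segment (h : ∀ k < s, a k ≤ a (k + 1)) {j : ℕ} (hj : j < s)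
    (h1 : a j ≤ t) (h2 : t ≤ a (j + 1)) :
    hFun coroot i (glsPath l a s) t =
      hFun coroot i (glsPath l a s) (a j) + (t - a j) * coroot i (l (j + 1)) := by
  rw [hFun, glsPath_segment h hj h1 h2, map_add, map_smul, smul_eq_mul, hFun]

lemma hFun_segment_end (h : ∀ k < s, a k ≤ a (k + 1)) {j : ℕ} (hj : j < s) :
    hFun coroot i (glsPath l a s) (a (j + 1)) =
      hFun coroot i (glsPath l a s) (a j) + (a (j + 1) - a j) * coroot i (l (j + 1)) :=
  hFun_segment h hj (h j hj) le_rfl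

lemma exists_mem_hFun_ge (h : ∀ k < s, a k ≤ a (k + 1)) {j : ℕ} (hj : j < s)
    (h1 : a j ≤ t) (h2 : t ≤ a (j + 1)) :
    hFun coroot i (glsPath l a s) (a j) ≤ hFun coroot i (glsPath l a s) t ∨
    hFun coroot i (glsPath l a s) (a (j + 1)) ≤ hFun coroot i (glsPath l a s) t := by
  rw [hFun_segment_end h hj, hFun_segment h hj h1 h2]
  rcases le_total 0 (coroot i (l (j + 1))) with hc | hc
  · left
    nlinarith
  · right
    nlinarith

namespace WeakGLS

variable (W : WeakGLS A α coroot lam s l a)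
include W

lemma a_nonneg {k : ℕ} (hk : k ≤ s) : 0 ≤ a k :=
  W.zero.symm.trans_le (le_of_le_succ W.le_succ (Nat.zero_le k) hk)

lemma a_le_one {k : ℕ} (hk : k ≤ s) : a k ≤ 1 :=
  (le_of_le_succ W.le_succ hk le_rfl).trans_eq W.one

lemma a_lt (hs : ∀ k < s, a k < a (k + 1)) {j k : ℕ} (hjk : j < k) (hk : k ≤ s) : a j < a k :=
  (hs j (by omega)).trans_le (le_of_le_succ W.le_succ hjk hk)

lemma hFun_zero : hFun coroot i (glsPath l a s) 0 = 0 := by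
  rw [hFun, glsPath_zero W.le_succ W.zero, map_zero]

lemma hFun_sub_integral (hD : IsRealization A α coroot) {k : ℕ} (hk : k ≤ s) :
    ∃ m : ℤ, hFun coroot i (glsPath l a s) (a k) - a k * coroot i (l (k + 1)) = m := by
  induction k with
  | zero => exact ⟨0, by simp [W.zero, W.hFun_zero]⟩
  | succ k ih =>
    obtain ⟨m, hm⟩ := ih (by omega)
    obtain ⟨n, hn⟩ := hD.reflTransGen_sub_integral i (W.chain (k + 1) (by omega) hk)
    refine ⟨m + n, ?_⟩
    rw [hFun_segment_end W.le_succ hk]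
    push_cast
    rw [← hm, ← hn]
    ring

lemma hFun_integral (hD : IsRealization A α coroot) (hi : A i i = 2) {k : ℕ} (hk : k ≤ s)
    (hpos : 0 < a k) (h1 : coroot i (l k) ≤ 0)
    (h2 : 0 < coroot i (l (k + 1)) ∨ ∃ m : ℤ, a k * coroot i (l (k + 1)) = m) :
    ∃ m : ℤ, hFun coroot i (glsPath l a s) (a k) = m := by
  have hk1 : 1 ≤ k := by
    rcases Nat.eq_zero_or_pos k with rfl | hk
    · exact absurd W.zero hpos.ne'
    · exact hk
  have hc := W.chain k hk1 hk
  obtain ⟨m, hm⟩ := (hD.reflTransGen_upperRefl hi hpos hc h2).1.resolve_left h1.not_gt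
  obtain ⟨n, hn⟩ := hD.reflTransGen_sub_integral i hc
  obtain ⟨u, hu⟩ := W.hFun_sub_integral (i := i) hD hk
  refine ⟨u + (m - n), ?_⟩
  push_cast
  rw [← hu, ← hm, ← hn]
  ring

lemma mOf_le (hD : IsRealization A α coroot) (hi : A i i = 2) (hlam : lam ∈ Pplus coroot)
    (hs : ∀ k < s, a k < a (k + 1)) (h0 : 0 ≤ t) (h1 : t ≤ 1) :
    (mOf coroot i (glsPath l a s) : ℚ) ≤ hFun coroot i (glsPath l a s) t := by
  obtain ⟨k, hk, hmin⟩ := Finset.exists_min_image (Finset.range (s + 1))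
    (fun k => hFun coroot i (glsPath l a s) (a k)) ⟨0, by simp⟩
  simp only [Finset.mem_range, Nat.lt_succ_iff] at hk hmin
  have hge : ∀ t, 0 ≤ t → t ≤ 1 →
      hFun coroot i (glsPath l a s) (a k) ≤ hFun coroot i (glsPath l a s) t := by
    intro t h0 h1
    rcases h0.eq_or_lt with rfl | h0
    · have := hmin 0 (Nat.zero_le _)
      rwa [W.zero] at this
    · obtain ⟨j, hj, hj1, hj2⟩ := exists_segment (W.zero.trans_lt h0) (h1.trans_eq W.one.symm)
      rcases exists_mem_hFun_ge (coroot := coroot) (l := l) (i := i) W.le_succ hj hj1.le hj2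
        with h | h
      · exact (hmin j hj.le).trans h
      · exact (hmin (j + 1) hj).trans h
  have hint : ∃ m : ℤ, hFun coroot i (glsPath l a s) (a k) = m := by
    rcases Nat.eq_zero_or_pos k with rfl | hk0
    · exact ⟨0, by simp [W.zero, W.hFun_zero]⟩
    · obtain ⟨j, rfl⟩ := Nat.exists_eq_add_of_le' hk0
      refine W.hFun_integral hD hi hk ((W.a_nonneg (by omega)).trans_lt (hs j hk)) ?_ ?_
      · have := hmin j (by omega)
        rw [hFun_segment_end W.le_succ hk] at this
        have := hs j hk
        by_contra! hc
        nlinarith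
      · rcases hk.eq_or_lt with rfl | hk
        · obtain ⟨n, hn⟩ := hlam.1 i
          exact Or.inr ⟨n, by rw [W.one, W.last, hn, one_mul]⟩
        · have h2 := hmin (j + 1 + 1) hk
          rw [hFun_segment_end W.le_succ hk] at h2
          have h3 := hs (j + 1) hk
          have : 0 ≤ coroot i (l (j + 1 + 1)) := by
            by_contra! hc
            nlinarith
          exact this.lt_or_eq.imp id fun h => ⟨0, by rw [← h]; simp⟩
  obtain ⟨m, hm⟩ := hint
  have : mOf coroot i (glsPath l a s) = m := by
    refine IsLeast.csInf_eq ⟨⟨a k, W.a_nonneg hk, W.a_le_one hk, hm⟩, ?_⟩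
    rintro n ⟨t, h0, h1, hn⟩
    have := hge t h0 h1
    rw [hm, hn] at this
    exact_mod_cast this
  rw [this, ← hm]
  exact hge t h0 h1

end WeakGLS

lemma fPath_of_le {tp tm : ℚ} {π : ℚ → V} (h : t ≤ tp) :
    fPath α coroot i tp tm π t = π t := if_pos h

lemma fPath_of_mem {tp tm : ℚ} {π : ℚ → V} (h1 : tp ≤ t) (h2 : t ≤ tm) :
    fPath α coroot i tp tm π t = π tp + srefl α coroot i (π t - π tp) := by
  rcases h1.eq_or_lt with rfl | h1
  · rw [fPath_of_le le_rfl, sub_self, map_zero, add_zero]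
  · rw [fPath, if_neg h1.not_ge, if_pos h2]

lemma fPath_of_ge {tp tm : ℚ} {π : ℚ → V} (h : tp < tm)
    (hπ : hFun coroot i π tm = hFun coroot i π tp + 1) (h2 : tm ≤ t) :
    fPath α coroot i tp tm π t = π t - α i := by
  rcases h2.eq_or_lt with rfl | h2
  · rw [hFun, hFun] at hπ
    rw [fPath_of_mem h.le le_rfl, srefl_apply, map_sub, hπ, add_sub_cancel_left]
    module
  · rw [fPath, if_neg (h.trans h2).not_ge, if_neg h2.not_ge]

/-- The position of the cutting points of the path operator `f_i` among the breakpoints. -/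
structure FCut (coroot : I → (V →ₗ[ℚ] ℚ)) (i : I) (s : ℕ) (l : ℕ → V) (a : ℕ → ℚ)
    (tt q : ℕ) (tm : ℚ) : Prop where
  plus : IsFPlus coroot i (glsPath l a s) (a tt)
  minus : IsFMinus coroot i (glsPath l a s) (a tt) tm
  le : tt ≤ q
  lt : q < s
  left : a q < tm
  right : tm ≤ a (q + 1)

namespace FCut

variable {tt q : ℕ} {tm : ℚ} (C : FCut coroot i s l a tt q tm)
  (W : WeakGLS A α coroot lam s l a) (hD : IsRealization A α coroot) (hi : A i i = 2)
  (hlam : lam ∈ Pplus coroot) (hs : ∀ k < s, a k < a (k + 1))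

include C W hs in
lemma mOf_ne {k : ℕ} (hk : tt < k) (hk' : k ≤ s) :
    hFun coroot i (glsPath l a s) (a k) ≠ mOf coroot i (glsPath l a s) := fun h =>
  (C.plus.2.2.2 _ (W.a_nonneg hk') (W.a_le_one hk') h).not_gt (W.a_lt hs hk hk')

include C W hD hi hlam hs in
lemma mOf_lt {k : ℕ} (hk : tt < k) (hk' : k ≤ s) :
    mOf coroot i (glsPath l a s) < hFun coroot i (glsPath l a s) (a k) :=
  (W.mOf_le hD hi hlam hs (W.a_nonneg hk') (W.a_le_one hk')).lt_of_ne (C.mOf_ne W hs hk hk').symm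

include C W hD hi hlam hs in
lemma coroot_nonpos (h : 1 ≤ tt) : coroot i (l tt) ≤ 0 := by
  have hC := C.le
  have hC' := C.lt
  obtain ⟨j, rfl⟩ := Nat.exists_eq_add_of_le' h
  have h1 := W.mOf_le hD hi hlam hs (W.a_nonneg (show j ≤ s by omega))
    (W.a_le_one (show j ≤ s by omega))
  have h2 := C.plus.2.2.1
  rw [hFun_segment_end W.le_succ (by omega)] at h2
  have := hs j (by omega)
  by_contra! hc
  nlinarith

include C W in
lemma hFun_lt {k : ℕ} (hk : tt ≤ k) (hk' : k ≤ q) :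
    hFun coroot i (glsPath l a s) (a k) < mOf coroot i (glsPath l a s) + 1 := by
  have hC' := C.lt
  induction k, hk using Nat.le_induction with
  | base => rw [C.plus.2.2.1]; linarith
  | succ k hk ih =>
    specialize ih (by omega)
    by_contra! hge
    have hks : k < s := by omega
    rw [hFun_segment_end W.le_succ hks] at hge
    have h1 := W.le_succ k hks
    have hpos : 0 < coroot i (l (k + 1)) := by
      by_contra! hc
      nlinarith
    set y := mOf coroot i (glsPath l a s) + 1 - hFun coroot i (glsPath l a s) (a k) with hy
    have hy0 : 0 < y := by linarith
    have hx0 : 0 < y / coroot i (l (k + 1)) := div_pos hy0 hpos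
    have hx1 : y / coroot i (l (k + 1)) ≤ a (k + 1) - a k := by
      rw [div_le_iff₀ hpos]
      linarith
    have h2 := hFun_segment (coroot := coroot) (l := l) (i := i) W.le_succ hks
      (t := a k + y / coroot i (l (k + 1))) (by linarith) (by linarith)
    rw [add_sub_cancel_left, div_mul_cancel₀ _ hpos.ne'] at h2
    have h3 := le_of_le_succ W.le_succ hk hks.le
    have h4 := W.a_le_one (show k + 1 ≤ s from hks)
    have h5 := C.minus.2.2.2 (a k + y / coroot i (l (k + 1))) (by linarith) (by linarith)
      (by rw [h2]; linarith)
    have h6 := le_of_le_succ W.le_succ hk' hC'.le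
    have h7 := C.left
    linarith

include C W in
lemma hFun_tm : hFun coroot i (glsPath l a s) (a q) + (tm - a q) * coroot i (l (q + 1)) =
    mOf coroot i (glsPath l a s) + 1 := by
  rw [← hFun_segment W.le_succ C.lt C.left.le C.right, C.minus.2.2.1]

include C W hD hi hlam hs in
lemma coroot_pos {k : ℕ} (hk : tt ≤ k) (hk' : k ≤ q) : 0 < coroot i (l (k + 1)) := by
  have hC' := C.lt
  induction hk' using Nat.decreasingInduction with
  | self =>
    have h1 := C.hFun_tm W
    have h2 := C.hFun_lt W hk le_rfl
    have h3 := C.left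
    by_contra! hc
    nlinarith
  | of_succ k hkq ih =>
    specialize ih (by omega)
    by_contra! hc
    obtain ⟨m, hm⟩ := W.hFun_integral hD hi (show k + 1 ≤ s by omega)
      ((W.a_nonneg (by omega)).trans_lt (hs k (by omega))) hc (Or.inl ih)
    have h1 := C.mOf_lt W hD hi hlam hs (show tt < k + 1 by omega) (by omega)
    have h2 := C.hFun_lt W (show tt ≤ k + 1 by omega) hkq
    rw [hm] at h1 h2
    norm_cast at h1 h2
    omega

include C W hD in
lemma tm_mul_integral : ∃ m : ℤ, tm * coroot i (l (q + 1)) = m := by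
  obtain ⟨m, hm⟩ := W.hFun_sub_integral (i := i) hD C.lt.le
  refine ⟨mOf coroot i (glsPath l a s) + 1 - m, ?_⟩
  push_cast
  rw [← hm, ← C.hFun_tm W]
  ring

include C W hD hi hlam hs in
lemma weakGLS : WeakGLS A α coroot lam (s + 1)
    (fun k => if k ≤ tt then l k else if k ≤ q + 1 then srefl α coroot i (l k) else l (k - 1))
    (fun k => if k ≤ q then a k else if k = q + 1 then tm else a (k - 1)) where
  one_le := by omega
  zero := by simp [W.zero]
  one := by
    have := C.lt
    rw [if_neg (by omega), if_neg (by omega), Nat.add_sub_cancel, W.one]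
  le_succ k hk := by
    have h1 := C.lt
    have h2 := C.left
    have h3 := C.right
    rcases lt_trichotomy k q with h | rfl | h
    · rw [if_pos h.le, if_pos (by omega : k + 1 ≤ q)]
      exact W.le_succ k (by omega)
    · rw [if_pos le_rfl, if_neg (by omega), if_pos rfl]
      exact h2.le
    · rw [if_neg h.not_ge, if_neg (by omega : ¬ k + 1 ≤ q), if_neg (by omega : ¬ k + 1 = q + 1),
        Nat.add_sub_cancel]
      split_ifs with h4
      · rwa [h4]
      · obtain ⟨j, rfl⟩ := Nat.exists_eq_add_of_le' (show 1 ≤ k by omega)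
        exact W.le_succ j (by omega)
  mem k hk hk' := by
    have h1 := C.lt
    have h2 := C.le
    split_ifs
    · exact W.mem k hk (by omega)
    · exact srefl_mem_Torbit i (W.mem k hk (by omega))
    · exact W.mem (k - 1) (by omega) (by omega)
  chain k hk hk' := by
    have h1 := C.lt
    have h2 := C.le
    have hpos : ∀ k, 1 ≤ k → k ≤ s → 0 < a k := fun k hk hk' =>
      W.zero.symm.trans_lt (W.a_lt hs hk hk')
    rcases lt_trichotomy k (q + 1) with h | rfl | h
    · rw [if_pos (by omega : k ≤ q), if_pos (by omega : k ≤ q + 1),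
        if_pos (by omega : k + 1 ≤ q + 1)]
      rcases lt_or_ge k tt with h3 | h3
      · rw [if_pos h3.le, if_pos (by omega : k + 1 ≤ tt)]
        exact W.chain k hk (by omega)
      · have hp := C.coroot_pos W hD hi hlam hs h3 (by omega)
        have hM := (hD.reflTransGen_upperRefl hi (hpos k hk (by omega)) (W.chain k hk (by omega))
          (Or.inl hp)).2
        rw [upperRefl_of_pos hp] at hM
        rw [if_neg (by omega : ¬ k + 1 ≤ tt)]
        rcases h3.eq_or_lt with rfl | h3
        · rw [upperRefl_of_nonpos (C.coroot_nonpos W hD hi hlam hs hk)] at hM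
          rwa [if_pos le_rfl]
        · obtain ⟨j, rfl⟩ := Nat.exists_eq_add_of_le' hk
          rw [upperRefl_of_pos (C.coroot_pos W hD hi hlam hs (by omega) (by omega))] at hM
          rwa [if_neg h3.not_ge]
    · rw [if_neg (by omega : ¬ q + 1 ≤ q), if_pos rfl, if_neg (by omega : ¬ q + 1 ≤ tt),
        if_pos le_rfl, if_neg (by omega : ¬ q + 1 + 1 ≤ tt), if_neg (by omega),
        Nat.add_sub_cancel]
      exact .single (hD.aStep_simple hi (W.mem (q + 1) hk h1)
        ((W.a_nonneg h1.le).trans_lt C.left)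
        (C.coroot_pos W hD hi hlam hs h2 le_rfl) (C.tm_mul_integral W hD))
    · rw [if_neg (by omega : ¬ k ≤ q), if_neg (by omega : ¬ k = q + 1),
        if_neg (by omega : ¬ k ≤ tt), if_neg (by omega : ¬ k ≤ q + 1),
        if_neg (by omega : ¬ k + 1 ≤ tt), if_neg (by omega : ¬ k + 1 ≤ q + 1),
        Nat.add_sub_cancel]
      obtain ⟨j, rfl⟩ := Nat.exists_eq_add_of_le' hk
      exact W.chain j (by omega) (by omega)
  last := by
    have h1 := C.lt
    have h2 := C.le
    rw [if_neg (by omega), if_neg (by omega), Nat.add_sub_cancel, W.last]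

include C W hD hi hlam hs in
lemma fPath_eq : pathEq (fPath α coroot i (a tt) tm (glsPath l a s)) (glsPath
    (fun k => if k ≤ tt then l k else if k ≤ q + 1 then srefl α coroot i (l k) else l (k - 1))
    (fun k => if k ≤ q then a k else if k = q + 1 then tm else a (k - 1)) (s + 1)) := by
  have W' := C.weakGLS W hD hi hlam hs
  have h1 := C.lt
  have h2 := C.le
  have h3 := C.left
  have h4 := C.right
  have h5 := le_of_le_succ W.le_succ h2 h1.le
  have hge : ∀ t, tm ≤ t →
      fPath α coroot i (a tt) tm (glsPath l a s) t = glsPath l a s t - α i := fun t =>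
    fPath_of_ge (h5.trans_lt h3) (by rw [C.minus.2.2.1, C.plus.2.2.1])
  have hmid : ∀ j, tt ≤ j → j ≤ q → ∀ t, a j ≤ t → t ≤ a (j + 1) → t ≤ tm →
      fPath α coroot i (a tt) tm (glsPath l a s) t =
        fPath α coroot i (a tt) tm (glsPath l a s) (a j) +
          (t - a j) • srefl α coroot i (l (j + 1)) := by
    intro j hj1 hj2 t ht1 ht2 ht3
    have h6 := le_of_le_succ W.le_succ hj1 (by omega)
    rw [fPath_of_mem (h6.trans ht1) ht3, fPath_of_mem h6 (ht1.trans ht3),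
      glsPath_segment W.le_succ (by omega) ht1 ht2, add_sub_right_comm, map_add, map_smul,
      add_assoc]
  intro t ht0 ht1
  refine eq_glsPath_of_segment W'.le_succ W'.zero ?_ ?_ ht0 (ht1.trans_eq W'.one.symm)
  · rw [fPath_of_le (W.a_nonneg (by omega)), glsPath_zero W.le_succ W.zero]
  intro j hj t ht1 ht2
  rcases lt_trichotomy j q with h | rfl | h
  · rw [if_pos h.le] at ht1 ⊢
    rw [if_pos (by omega)] at ht2
    rcases lt_or_ge j tt with h6 | h6
    · have h7 := le_of_le_succ W.le_succ (show j + 1 ≤ tt from h6) (by omega)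
      rw [if_pos (by omega : j + 1 ≤ tt), fPath_of_le (ht2.trans h7), fPath_of_le ((ht1.trans ht2).trans h7)]
      exact glsPath_segment W.le_succ (by omega) ht1 ht2
    · have h7 := le_of_le_succ W.le_succ (show j + 1 ≤ q from h) (by omega)
      rw [if_neg (by omega), if_pos (by omega)]
      exact hmid j h6 h.le t ht1 ht2 (ht2.trans (h7.trans h3.le))
  · rw [if_pos le_rfl] at ht1 ⊢
    rw [if_neg (by omega), if_pos rfl] at ht2
    rw [if_neg (by omega), if_pos le_rfl]
    exact hmid j h2 le_rfl t ht1 (ht2.trans h4) ht2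
  · obtain ⟨k, rfl⟩ := Nat.exists_eq_add_of_le' (show 1 ≤ j by omega)
    rw [if_neg (by omega : ¬ k + 1 ≤ q), Nat.add_sub_cancel] at ht1 ⊢
    rw [if_neg (by omega : ¬ k + 1 + 1 ≤ q), if_neg (by omega : ¬ k + 1 + 1 = q + 1),
      Nat.add_sub_cancel] at ht2
    rw [if_neg (by omega : ¬ k + 1 + 1 ≤ tt), if_neg (by omega : ¬ k + 1 + 1 ≤ q + 1),
      Nat.add_sub_cancel]
    rcases (show q ≤ k by omega).eq_or_lt with rfl | h6
    · rw [if_pos rfl] at ht1 ⊢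
      rw [hge t ht1, hge tm le_rfl, glsPath_segment W.le_succ h1 (h3.le.trans ht1) ht2,
        glsPath_segment W.le_succ h1 h3.le h4]
      module
    · rw [if_neg (by omega : ¬ k + 1 = q + 1)] at ht1 ⊢
      have h7 := le_of_le_succ W.le_succ (show q + 1 ≤ k from h6) (by omega)
      rw [hge t (h4.trans (h7.trans ht1)), hge (a k) (h4.trans h7),
        glsPath_segment W.le_succ (by omega) ht1 ht2]
      module

end FCut

variable (W : WeakGLS A α coroot lam s l a) (hD : IsRealization A α coroot) (hi : A i i = 2)
  (hlam : lam ∈ Pplus coroot) (hs : ∀ k < s, a k < a (k + 1))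

include W hD hi hlam hs in
lemma WeakGLS.exists_breakpoint {tp : ℚ} (h : IsFPlus coroot i (glsPath l a s) tp) :
    ∃ k ≤ s, a k = tp := by
  obtain ⟨h0, h1, h2, h3⟩ := h
  rcases h0.eq_or_lt with rfl | h0
  · exact ⟨0, Nat.zero_le _, W.zero⟩
  · obtain ⟨j, hj, h4, h5⟩ := exists_segment (W.zero.trans_lt h0) (h1.trans_eq W.one.symm)
    rcases h5.eq_or_lt with rfl | h5
    · exact ⟨j + 1, hj, rfl⟩
    · have h6 := W.mOf_le hD hi hlam hs (W.a_nonneg hj.le) (W.a_le_one hj.le)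
      have h7 := W.mOf_le hD hi hlam hs (W.a_nonneg hj) (W.a_le_one hj)
      have h8 := h3 _ (W.a_nonneg hj) (W.a_le_one hj)
      rw [hFun_segment_end W.le_succ hj] at h7 h8
      rw [hFun_segment W.le_succ hj h4.le h5.le] at h2
      refine absurd (h8 (le_antisymm ?_ h7)) h5.not_ge
      by_contra! hc
      rcases le_or_gt (coroot i (l (j + 1))) 0 with hc' | hc' <;> nlinarith

include W hD hi hlam hs in
lemma WeakGLS.exists_fCut {tp tm : ℚ} (hp : IsFPlus coroot i (glsPath l a s) tp)
    (hm : IsFMinus coroot i (glsPath l a s) tp tm) :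
    ∃ tt q, a tt = tp ∧ FCut coroot i s l a tt q tm := by
  obtain ⟨tt, htt, rfl⟩ := W.exists_breakpoint hD hi hlam hs hp
  have hlt : a tt < tm := by
    refine hm.1.lt_of_ne fun h => ?_
    have h1 := hp.2.2.1
    rw [h, hm.2.2.1] at h1
    linarith
  obtain ⟨q, hq, h1, h2⟩ := exists_segment
    (W.zero.trans_lt ((W.a_nonneg htt).trans_lt hlt)) (hm.2.1.trans_eq W.one.symm)
  refine ⟨tt, q, rfl, hp, hm, ?_, hq, h1, h2⟩
  by_contra! hc
  exact (h2.trans (le_of_le_succ W.le_succ hc htt)).not_gt hlt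

omit [AddCommGroup V] [Module ℚ V] in
lemma pathEq.trans {π π' π'' : ℚ → V} (h : pathEq π π') (h' : pathEq π' π'') : pathEq π π'' :=
  fun t h0 h1 => (h t h0 h1).trans (h' t h0 h1)

lemma glsPath_update (s : ℕ) (l : ℕ → V) (a : ℕ → ℚ) (lam : V) :
    glsPath l a s = glsPath (Function.update l (s + 1) lam) a s :=
  funext <| glsPath_congr fun k _ hk => (Function.update_of_ne (by omega) _ _).symm

include W hD hi hlam hs in
lemma FCut.exists_mem_GLSset {tt q : ℕ} {tm : ℚ} (C : FCut coroot i s l a tt q tm) :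
    ∃ ρ ∈ GLSset A α coroot lam,
      pathEq (fPath α coroot i (a tt) tm (glsPath l a s)) ρ := by
  obtain ⟨ρ, hρ, hρ'⟩ := (C.weakGLS W hD hi hlam hs).exists_mem_GLSset
  exact ⟨ρ, hρ, (C.fPath_eq W hD hi hlam hs).trans hρ'⟩

include hD hi hlam in
/-- The set of generalized Lakshmibai–Seshadri paths is stable under `f_i` for `i` real. -/
lemma exists_mem_GLSset_of_fRel {σ σ' : ℚ → V} (hσ : σ ∈ GLSset A α coroot lam)
    (h : FRel α coroot i σ σ') : ∃ ρ ∈ GLSset A α coroot lam, pathEq σ' ρ := by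
  obtain ⟨s, l, a, hg, rfl⟩ := hσ
  obtain ⟨tp, tm, hp, -, hm, he⟩ := h
  rw [glsPath_update s l a lam] at hp hm he
  obtain ⟨tt, q, rfl, C⟩ := hg.weakGLS.exists_fCut hD hi hlam hg.2.2.2.1 hp hm
  obtain ⟨ρ, hρ, hρ'⟩ := C.exists_mem_GLSset hg.weakGLS hD hi hlam hg.2.2.2.1
  exact ⟨ρ, hρ, he.trans hρ'⟩

end Slopes
end GKM

open GKM in
/-- Action of `f_i`, `i` real, on a GLS path
`π = (λ_1, …, λ_s ; a_0, …, a_s)` with `f_+^i(π) = a_t` and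
`a_{p-1} < f_-^i(π) ≤ a_p`:
`f_i π = (λ_1, …, λ_t, r_i λ_{t+1}, …, r_i λ_p, λ_p, …, λ_s ;
a_0, …, a_{p-1}, f_-^i(π), a_p, …, a_s)`, and this (after dropping repeated terms) is
again a GLS path of shape `λ`; in particular `ℙ_λ` is stable under all `f_i`, `i` real. -/
theorem stmt15 {I V : Type*} [Countable I] [AddCommGroup V] [Module ℚ V]
    (A : I → I → ℤ) (α : I → V) (coroot : I → (V →ₗ[ℚ] ℚ))
    (hind : LinearIndependent ℚ α)
    (hpair : ∀ i j, coroot i (α j) = (A i j : ℚ))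
    (hdiag : ∀ i, A i i = 2 ∨ A i i ≤ 0)
    (hoff : ∀ i j, i ≠ j → A i j ≤ 0)
    (hzero : ∀ i j, A i j = 0 ↔ A j i = 0)
    (lam : V) (hlam : lam ∈ Pplus coroot)
    (s : ℕ) (lamseq : ℕ → V) (a : ℕ → ℚ)
    (hgls : IsGLS A α coroot lam s lamseq a)
    (i : I) (hi : A i i = 2)
    (tt : ℕ) (htt : tt ≤ s)
    (hfp : IsFPlus coroot i (glsPath lamseq a s) (a tt))
    (hnz : a tt < 1)
    (tm : ℚ) (hfm : IsFMinus coroot i (glsPath lamseq a s) (a tt) tm)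
    (p : ℕ) (hp1 : tt + 1 ≤ p) (hp2 : p ≤ s)
    (hpm : a (p - 1) < tm) (hpm' : tm ≤ a p) :
    pathEq (fPath α coroot i (a tt) tm (glsPath lamseq a s))
      (glsPath
        (fun k => if k ≤ tt then lamseq k
          else if k ≤ p then srefl α coroot i (lamseq k)
          else lamseq (k - 1))
        (fun k => if k ≤ p - 1 then a k else if k = p then tm else a (k - 1))
        (s + 1)) ∧
    (∃ ρ ∈ GLSset A α coroot lam,
      pathEq (fPath α coroot i (a tt) tm (glsPath lamseq a s)) ρ) ∧
    (∀ j : I, A j j = 2 → ∀ σ ∈ GLSset A α coroot lam, ∀ σ' : ℚ → V,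
      FRel α coroot j σ σ' → ∃ ρ ∈ GLSset A α coroot lam, pathEq σ' ρ) := by
  have hD : IsRealization A α coroot := ⟨hind, hpair, hoff, hzero⟩
  have hs := hgls.2.2.2.1
  obtain ⟨q, rfl⟩ := Nat.exists_eq_add_of_le' (show 1 ≤ p by omega)
  rw [glsPath_update s lamseq a lam] at hfp hfm ⊢
  rw [Nat.add_sub_cancel] at hpm ⊢
  have C : FCut coroot i s (Function.update lamseq (s + 1) lam) a tt q tm :=
    ⟨hfp, hfm, by omega, hp2, hpm, hpm'⟩
  refine ⟨fun t h0 h1 => ?_, C.exists_mem_GLSset hgls.weakGLS hD hi hlam hs,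
    fun j hj σ hσ σ' h => exists_mem_GLSset_of_fRel hD hj hlam hσ h⟩
  rw [C.fPath_eq hgls.weakGLS hD hi hlam hs t h0 h1]
  refine glsPath_congr (fun k hk hk' => ?_) t
  split_ifs
  · exact Function.update_of_ne (by omega) _ _
  · rw [Function.update_of_ne (by omega)]
  · exact Function.update_of_ne (by omega) _ _
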